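/- arXiv:math/0409588 — 3 statements merged into one kernel-verified Lean document; each statement's English description precedes it below -/
import Mathlib

section
/- Let G be a finite abelian group. For every sequence (g_k), k = 1, ..., |G|, of |G| elements of G there is a nonempty subset K of the index set {1, ..., |G|} such that the subsequence (g_k)_{k ∈ K} satisfies ∑_{k ∈ K} g_k = 0_G and ∑_{k ∈ K} 1/|g_k| ≤ 1 (the latter sum taken in the rationals). -/
namespace ZSR

open Multiset

/-- Pebbling style reductions of multisets of labels. -/
inductive Red {G : Type*} [AddCommGroup G] : Multiset G → Multiset G → Prop
  | le {s t : Multiset G} (h : t ≤ s) : Red s t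
  | trans {s t u : Multiset G} (h₁ : Red s t) (h₂ : Red t u) : Red s u
  | add {s t : Multiset G} (u : Multiset G) (h : Red s t) : Red (s + u) (t + u)
  | mul (p : ℕ) (hp : p.Prime) (g : G) : Red (replicate p g) {p • g}
  | cell {g g' : G} (h : AddSubgroup.zmultiples g = AddSubgroup.zmultiples g') : Red {g} {g'}

section basic
variable {G : Type*} [AddCommGroup G]

lemma Red.refl (s : Multiset G) : Red s s := Red.le le_rfl

lemma Red.add_both {s t s' t' : Multiset G} (h : Red s t) (h' : Red s' t') :
    Red (s + s') (t + t') := by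
  refine (h.add s').trans ?_
  rw [add_comm t, add_comm t]
  exact h'.add t

lemma Red.map_cells {α : Type*} (S : Multiset α) (f f' : α → G)
    (h : ∀ a ∈ S, AddSubgroup.zmultiples (f a) = AddSubgroup.zmultiples (f' a)) :
    Red (S.map f) (S.map f') := by
  induction S using Multiset.induction_on with
  | empty => exact Red.refl _
  | cons a S ih =>
    rw [map_cons, map_cons, ← singleton_add, ← singleton_add]
    exact (Red.cell (h a (mem_cons_self a S))).add_both
      (ih fun b hb => h b (mem_cons_of_mem hb))

lemma Red.pow (p : ℕ) (hp : p.Prime) (k : ℕ) (g : G) :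
    Red (replicate (p ^ k) g) {p ^ k • g} := by
  induction k with
  | zero => rw [pow_zero, replicate_one, one_smul]; exact Red.refl _
  | succ k ih =>
    have key : ∀ n : ℕ, Red (replicate (p ^ k * n) g) (replicate n (p ^ k • g)) := by
      intro n
      induction n with
      | zero => simpa using Red.refl _
      | succ n ihn =>
        rw [mul_add, mul_one, replicate_add, replicate_add, replicate_one]
        exact ihn.add_both ih
    rw [pow_succ]
    refine (key p).trans ?_
    have := Red.mul p hp (p ^ k • g)
    rwa [smul_smul, mul_comm] at this

lemma Red.replicate {s : Multiset G} {g : G} (h : Red s {g}) (n : ℕ) :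
    Red (n • s) (replicate n g) := by
  induction n with
  | zero => simpa using Red.refl _
  | succ n ih =>
    rw [succ_nsmul, replicate_add, replicate_one]
    exact ih.add_both h

/-- Transport of a reduction along a function that is well behaved on generators. -/
lemma Red.mapFun {H : Type*} [AddCommGroup H] (f : H → G)
    (hc : ∀ h h', AddSubgroup.zmultiples h = AddSubgroup.zmultiples h' →
      AddSubgroup.zmultiples (f h) = AddSubgroup.zmultiples (f h'))
    (hm : ∀ p : ℕ, p.Prime → ∀ h, Red (Multiset.replicate p (f h)) {f (p • h)})
    {s t : Multiset H} (h : Red s t) : Red (s.map f) (t.map f) := by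
  induction h with
  | le h => exact Red.le (map_le_map h)
  | trans _ _ h1 h2 => exact h1.trans h2
  | add u _ h => rw [Multiset.map_add, Multiset.map_add]; exact h.add _
  | mul p hp g => rw [map_replicate, map_singleton]; exact hm p hp g
  | cell h => rw [map_singleton, map_singleton]; exact Red.cell (hc _ _ h)

lemma Red.mapHom {H : Type*} [AddCommGroup H] (f : H →+ G)
    {s t : Multiset H} (h : Red s t) : Red (s.map f) (t.map f) := by
  refine Red.mapFun f ?_ ?_ h
  · intro a b hab
    rw [← AddMonoidHom.map_zmultiples, ← AddMonoidHom.map_zmultiples, hab]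
  · intro p hp a
    rw [_root_.map_nsmul]
    exact Red.mul p hp _

end basic

section sound

lemma exists_sub_dvd (p : ℕ) (hp : 0 < p) {α : Type*} (c : α → ℤ) (M : Multiset α)
    (hM : card M = p) : ∃ U ≤ M, U ≠ 0 ∧ (p : ℤ) ∣ (U.map c).sum := by
  induction M using Quotient.inductionOn with
  | h L =>
    have hL : L.length = p := hM
    have : NeZero p := ⟨hp.ne'⟩
    let f : Fin (p + 1) → ZMod p := fun i => (((L.take i).map c).sum : ℤ)
    obtain ⟨i, j, hij, hf⟩ := Fintype.exists_ne_map_eq_of_card_lt f (by simp [ZMod.card])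
    wlog hlt : i < j generalizing i j
    · exact this j i hij.symm hf.symm (lt_of_le_of_ne (not_lt.mp hlt) hij.symm)
    refine ⟨((L.take j).drop i : List α), ?_, ?_, ?_⟩
    · exact (((List.drop_sublist _ _).trans (List.take_sublist _ _))).subperm
    · intro h
      have h2 : ((L.take j).drop i).length = 0 := by
        have := congrArg card h
        simpa using this
      rw [List.length_drop, List.length_take] at h2
      have := j.2
      have := hlt
      rw [Fin.lt_def] at this
      omega
    · have h3 : ((L.take j).map c).sum
          = ((L.take i).map c).sum + (((L.take j).drop i).map c).sum := by
        have : (L.take j) = (L.take i) ++ ((L.take j).drop i) := by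
          conv_lhs => rw [← List.take_append_drop i (L.take j)]
          rw [List.take_take, min_eq_left (by exact_mod_cast hlt.le)]
        conv_lhs => rw [this]
        rw [List.map_append, List.sum_append]
      have h4 : ((((L.take j).drop i).map c).sum : ZMod p) = 0 := by
        have : f j = f i + (((((L.take j).drop i).map c).sum : ℤ) : ZMod p) := by
          simp only [f]
          rw [h3]; push_cast; rfl
        rw [hf] at this
        have h5 := left_eq_add.mp this
        exact_mod_cast h5
      have := (ZMod.intCast_zmod_eq_zero_iff_dvd (((L.take j).drop i).map c).sum p).mp
        (by exact_mod_cast h4)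
      simpa using this

variable {G ι : Type*} [AddCommGroup G] [Finite G] (g : ι → G)

/-- A label together with the indices it stands for. -/
def Good (x : Multiset ι × G) : Prop :=
  x.1 ≠ 0 ∧ (x.1.map g).sum ∈ AddSubgroup.zmultiples x.2 ∧
    (x.1.map fun i => (1 : ℚ) / (addOrderOf (g i) : ℚ)).sum ≤ 1 / (addOrderOf x.2 : ℚ)

lemma map_eq_add_split {α β : Type*} (f : α → β) (M : Multiset α) (s u : Multiset β)
    (h : M.map f = s + u) : ∃ M1 M2, M = M1 + M2 ∧ M1.map f = s ∧ M2.map f = u := by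
  classical
  induction s using Multiset.induction_on generalizing M with
  | empty => exact ⟨0, M, by simp, by simp, by simpa using h⟩
  | cons b s ih =>
    rw [cons_add] at h
    obtain ⟨a, ha, hb, h2⟩ := (map_eq_cons f M (s + u) b).mpr h
    obtain ⟨M1, M2, h3, h4, h5⟩ := ih _ h2
    refine ⟨a ::ₘ M1, M2, ?_, by rw [map_cons, hb, h4], h5⟩
    rw [cons_add, ← h3, cons_erase ha]

lemma le_map_split {α β : Type*} (f : α → β) (M : Multiset α) (s : Multiset β)
    (h : s ≤ M.map f) : ∃ M1 M2, M = M1 + M2 ∧ M1.map f = s := by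
  obtain ⟨u, hu⟩ := Multiset.le_iff_exists_add.mp h
  obtain ⟨M1, M2, h1, h2, _⟩ := map_eq_add_split f M s u hu
  exact ⟨M1, M2, h1, h2⟩

lemma sound {S T : Multiset G} (h : Red S T) : ∀ M : Multiset (Multiset ι × G),
    M.map Prod.snd = S → (∀ x ∈ M, Good g x) →
    ∃ M' : Multiset (Multiset ι × G), M'.map Prod.snd = T ∧ (∀ x ∈ M', Good g x) ∧
      (M'.map Prod.fst).sum ≤ (M.map Prod.fst).sum := by
  induction h with
  | le h =>
    rintro M rfl hg
    obtain ⟨M1, M2, rfl, rfl⟩ := le_map_split _ _ _ h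
    refine ⟨M1, rfl, fun x hx => hg x (mem_add.mpr (Or.inl hx)), ?_⟩
    rw [Multiset.map_add, Multiset.sum_add]
    exact Multiset.le_add_right _ _
  | trans _ _ h1 h2 =>
    intro M hM hg
    obtain ⟨M', hM', hg', hle⟩ := h1 M hM hg
    obtain ⟨M'', hM'', hg'', hle'⟩ := h2 M' hM' hg'
    exact ⟨M'', hM'', hg'', hle'.trans hle⟩
  | add u _ h =>
    intro M hM hg
    obtain ⟨M1, M2, rfl, h1, h2⟩ := map_eq_add_split _ _ _ _ hM
    obtain ⟨M', hM', hg', hle⟩ := h M1 h1 fun x hx => hg x (mem_add.mpr (Or.inl hx))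
    refine ⟨M' + M2, by rw [Multiset.map_add, hM', h2], ?_, ?_⟩
    · intro x hx
      rcases mem_add.mp hx with hx | hx
      · exact hg' x hx
      · exact hg x (mem_add.mpr (Or.inr hx))
    · rw [Multiset.map_add, Multiset.sum_add, Multiset.map_add, Multiset.sum_add]
      exact add_le_add_left hle _
  | @cell a b hab =>
    intro M hM hg
    obtain ⟨x, rfl, hx⟩ := Multiset.map_eq_singleton.mp hM
    obtain ⟨K, l⟩ := x
    simp only at hx
    subst hx
    have := hg (K, l) (mem_singleton_self _)
    refine ⟨{(K, b)}, by simp, ?_, by simp⟩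
    intro y hy
    rw [mem_singleton.mp hy]
    refine ⟨this.1, hab ▸ this.2.1, ?_⟩
    have h3 := this.2.2
    rwa [← Nat.card_zmultiples l, hab, Nat.card_zmultiples] at h3
  | mul p hp a =>
    intro M hM hg
    have hcard : card M = p := by
      have := congrArg card hM
      simpa using this
    have hlab : ∀ x ∈ M, x.2 = a := by
      intro x hx
      have : x.2 ∈ M.map Prod.snd := mem_map_of_mem _ hx
      rw [hM] at this
      exact eq_of_mem_replicate this
    have hc : ∀ x ∈ M, ∃ c : ℤ, c • a = (x.1.map g).sum := by
      intro x hx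
      have := (hg x hx).2.1
      rw [hlab x hx] at this
      exact AddSubgroup.mem_zmultiples_iff.mp this
    classical
    let c : Multiset ι × G → ℤ := fun x => if h : x ∈ M then (hc x h).choose else 0
    have hcs : ∀ x ∈ M, c x • a = (x.1.map g).sum := by
      intro x hx
      simp only [c, dif_pos hx]
      exact (hc x hx).choose_spec
    -- a nonempty submultiset with good sum
    have key : ∃ U ≤ M, U ≠ 0 ∧ (∃ z : ℤ, (U.map c).sum • a = z • (p • a)) ∧
        (card U : ℚ) / addOrderOf a ≤ 1 / addOrderOf (p • a) := by
      have ha : 0 < addOrderOf a := addOrderOf_pos a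
      by_cases hd : p ∣ addOrderOf a
      · obtain ⟨U, hU, hU0, z, hz⟩ := exists_sub_dvd p hp.pos c M hcard
        refine ⟨U, hU, hU0, ⟨z, ?_⟩, ?_⟩
        · rw [hz, mul_comm, mul_smul, natCast_zsmul]
        · have h1 : addOrderOf (p • a) = addOrderOf a / p := by
            rw [addOrderOf_nsmul' a hp.ne_zero, Nat.gcd_eq_right hd]
          obtain ⟨e, he⟩ := hd
          rw [h1, he, Nat.mul_div_cancel_left _ hp.pos]
          have hcU : card U ≤ p := hcard ▸ card_le_card hU
          have he0 : 0 < e := Nat.pos_of_ne_zero (by rintro rfl; omega)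
          rw [div_le_div_iff₀ (by exact_mod_cast (he ▸ ha)) (by exact_mod_cast he0)]
          push_cast
          rw [one_mul]
          have : (card U : ℚ) ≤ p := by exact_mod_cast hcU
          gcongr
      · have hcop : Nat.Coprime (addOrderOf a) p := ((hp.coprime_iff_not_dvd).mpr hd).symm
        obtain ⟨x, hx⟩ : ∃ x, x ∈ M := by
          apply exists_mem_of_ne_zero
          rintro rfl
          simp at hcard
          exact hp.ne_zero hcard.symm
        refine ⟨{x}, singleton_le.mpr hx, by simp, ?_, ?_⟩
        · have h1 := Nat.isCoprime_iff_coprime.mpr hcop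
          obtain ⟨u, v, huv⟩ := h1
          refine ⟨c x * v, ?_⟩
          have h2 : a = v • (p • a) := by
            have : (u * (addOrderOf a : ℤ) + v * p) • a = a := by rw [huv, one_smul]
            rw [add_smul, mul_smul, mul_smul, natCast_zsmul, natCast_zsmul, addOrderOf_nsmul_eq_zero,
              smul_zero, zero_add] at this
            exact this.symm
          rw [mul_smul, ← h2]
          simp
        · rw [addOrderOf_nsmul' a hp.ne_zero, hcop]
          simp
    obtain ⟨U, hU, hU0, ⟨z, hz⟩, hcross⟩ := key
    have hUM : ∀ x ∈ U, x ∈ M := fun x hx => mem_of_le hU hx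
    refine ⟨{((U.map Prod.fst).sum, p • a)}, by simp, ?_, ?_⟩
    · intro y hy
      rw [mem_singleton.mp hy]
      refine ⟨?_, ?_, ?_⟩
      · obtain ⟨x, hx⟩ := exists_mem_of_ne_zero hU0
        intro h0
        have h1 : x.1 ≤ (U.map Prod.fst).sum := Multiset.single_le_sum (by simp) _ (mem_map_of_mem _ hx)
        simp only at h0
        rw [h0] at h1
        exact (hg x (hUM x hx)).1 (Multiset.le_zero.mp h1)
      · have h1 : (((U.map Prod.fst).sum).map g).sum = (U.map c).sum • a := by
          clear hz hcross hU0 hU hy y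
          induction U using Multiset.induction_on with
          | empty => simp
          | cons x U ih =>
            rw [map_cons, sum_cons, Multiset.map_add, sum_add, map_cons, sum_cons, add_smul,
              hcs x (hUM x (mem_cons_self _ _)), ih fun y hy => hUM y (mem_cons_of_mem hy)]
        change (((U.map Prod.fst).sum).map g).sum ∈ _
        rw [h1, hz]
        exact AddSubgroup.mem_zmultiples_iff.mpr ⟨z, rfl⟩
      · refine le_trans ?_ hcross
        clear hz hcross hU0 hU hy y
        change (((U.map Prod.fst).sum).map _).sum ≤ _
        induction U using Multiset.induction_on with
        | empty => simp
        | cons x U ih =>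
          have h2 := ih fun y hy => hUM y (mem_cons_of_mem hy)
          have h3 := (hg x (hUM x (mem_cons_self _ _))).2.2
          rw [hlab x (hUM x (mem_cons_self _ _))] at h3
          rw [map_cons, sum_cons, Multiset.map_add, sum_add, card_cons]
          push_cast
          rw [add_div, add_comm]
          exact add_le_add h2 h3
    · obtain ⟨V, rfl⟩ := Multiset.le_iff_exists_add.mp hU
      rw [map_singleton, sum_singleton, Multiset.map_add, sum_add]
      exact Multiset.le_add_right _ _

lemma final [Fintype ι] (h : Red (Finset.univ.val.map g) {0}) :
    ∃ K : Finset ι, K.Nonempty ∧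
      (∑ k ∈ K, g k = 0) ∧ (∑ k ∈ K, (1 : ℚ) / (addOrderOf (g k) : ℚ) ≤ 1) := by
  obtain ⟨M', h1, h2, h3⟩ := sound g h (Finset.univ.val.map fun i => (({i} : Multiset ι), g i))
    (by simp) (by
      intro x hx
      obtain ⟨i, _, rfl⟩ := mem_map.mp hx
      exact ⟨by simp, by simp, by simp⟩)
  obtain ⟨x, rfl, hx⟩ := Multiset.map_eq_singleton.mp h1
  obtain ⟨hK, hs, hc⟩ := h2 x (mem_singleton_self _)
  have h4 : x.1 ≤ (Finset.univ : Finset ι).val := by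
    rw [map_singleton, sum_singleton, Multiset.map_map] at h3
    simpa [Function.comp_def, Multiset.sum_map_singleton] using h3
  have hnd : x.1.Nodup := nodup_of_le h4 Finset.univ.nodup
  rw [hx] at hs hc
  refine ⟨⟨x.1, hnd⟩, ?_, ?_, ?_⟩
  · rw [Finset.nonempty_iff_ne_empty]
    intro h
    exact hK (congrArg Finset.val h)
  · simpa [Finset.sum] using hs
  · simpa [Finset.sum] using hc

end sound

section cells
variable {G : Type*} [AddCommGroup G]

open Classical in
/-- The number of different cyclic subgroups generated by the members. -/
noncomputable def q (S : Multiset G) : ℕ := (S.map AddSubgroup.zmultiples).toFinset.card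

lemma q_mono {S T : Multiset G} (h : S ≤ T) : q S ≤ q T := by
  classical
  apply Finset.card_le_card
  intro x hx
  rw [mem_toFinset] at hx ⊢
  exact mem_of_le (map_le_map h) hx

lemma q_le_card (S : Multiset G) : q S ≤ card S := by
  classical
  exact (toFinset_card_le _).trans (by simp)

lemma q_add_le (S T : Multiset G) : q (S + T) ≤ q S + q T := by
  classical
  unfold q
  rw [Multiset.map_add, toFinset_add]
  exact Finset.card_union_le _ _

/-- A function sending cells to cells does not increase the number of cells. -/
lemma q_le_of_map {α H : Type*} [AddCommGroup H] (S : Multiset α) (f : α → G) (f' : α → H)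
    (h : ∀ a ∈ S, ∀ b ∈ S, AddSubgroup.zmultiples (f' a) = AddSubgroup.zmultiples (f' b) →
      AddSubgroup.zmultiples (f a) = AddSubgroup.zmultiples (f b)) :
    q (S.map f) ≤ q (S.map f') := by
  classical
  unfold q
  rw [Multiset.map_map, Multiset.map_map]
  have hx : ∀ C ∈ (S.map (AddSubgroup.zmultiples ∘ f)).toFinset, ∃ a ∈ S,
      AddSubgroup.zmultiples (f a) = C := by
    intro C hC
    simpa using hC
  rcases S.empty_or_exists_mem with rfl | ⟨a0, -⟩
  · simp
  have : Nonempty α := ⟨a0⟩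
  choose! r hr hr' using hx
  refine Finset.card_le_card_of_injOn (fun C => AddSubgroup.zmultiples (f' (r C))) ?_ ?_
  · intro C hC
    simp only [Finset.mem_coe, mem_toFinset, mem_map, Function.comp]
    exact ⟨r C, hr C hC, rfl⟩
  · intro C hC D hD hCD
    rw [← hr' C hC, ← hr' D hD]
    exact h _ (hr C hC) _ (hr D hD) hCD

/-- A set of representatives of the cells. -/
lemma exists_section (S : Multiset G) : ∃ V ≤ S, card V = q S ∧ q V = q S := by
  classical
  have hx : ∀ C ∈ (S.map AddSubgroup.zmultiples).toFinset, ∃ a ∈ S,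
      AddSubgroup.zmultiples a = C := by
    intro C hC
    simpa using hC
  choose! r hr hr' using hx
  have hinj : Set.InjOn r ((S.map AddSubgroup.zmultiples).toFinset : Finset (AddSubgroup G)) := by
    intro C hC D hD h
    rw [← hr' C hC, ← hr' D hD, h]
  refine ⟨((S.map AddSubgroup.zmultiples).toFinset.image r).val, ?_, ?_, ?_⟩
  · rw [Multiset.le_iff_subset (Finset.nodup _)]
    intro a ha
    simp only [Finset.mem_val, Finset.mem_image] at ha
    obtain ⟨C, hC, rfl⟩ := ha
    exact hr C hC
  · rw [Finset.card_val, Finset.card_image_of_injOn hinj]; rfl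
  · unfold q
    congr 1
    ext C
    simp only [mem_toFinset, mem_map, Finset.mem_val, Finset.mem_image]
    constructor
    · rintro ⟨a, ⟨D, ⟨b, hb, rfl⟩, rfl⟩, rfl⟩
      exact ⟨_, hr _ (by simpa using ⟨b, hb, rfl⟩), rfl⟩
    · rintro ⟨b, hb, rfl⟩
      exact ⟨r (AddSubgroup.zmultiples b), ⟨_, ⟨b, hb, rfl⟩, rfl⟩,
        hr' _ (by simpa using ⟨b, hb, rfl⟩)⟩

lemma exists_le_card {α : Type*} (S : Multiset α) (n : ℕ) (h : n ≤ card S) :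
    ∃ U ≤ S, card U = n := by
  induction S using Quotient.inductionOn with
  | h L => exact ⟨(L.take n : List α), (List.take_sublist _ _).subperm, by simpa using h⟩

/-- Pigeonhole: many elements force a cell with many members. -/
lemma exists_cell (S : Multiset G) (p : ℕ) (h : (p - 1) * q S < card S) :
    ∃ (U : Multiset G) (a : G), U ≤ S ∧ card U = p ∧
      ∀ b ∈ U, AddSubgroup.zmultiples b = AddSubgroup.zmultiples a := by
  classical
  by_contra hcon
  push Not at hcon
  have hb : ∀ C ∈ (S.map AddSubgroup.zmultiples).toFinset,
      (S.map AddSubgroup.zmultiples).count C ≤ p - 1 := by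
    intro C hC
    by_contra hlt
    rw [mem_toFinset, mem_map] at hC
    obtain ⟨a, ha, rfl⟩ := hC
    rw [count_map] at hlt
    obtain ⟨U, hU, hUc⟩ := exists_le_card
      (S.filter fun b => AddSubgroup.zmultiples a = AddSubgroup.zmultiples b) p (by omega)
    obtain ⟨b, hb, hne⟩ := hcon U a (hU.trans (filter_le _ _)) hUc
    exact hne (mem_filter.mp (mem_of_le hU hb)).2.symm
  have h1 := toFinset_sum_count_eq (S.map AddSubgroup.zmultiples)
  rw [card_map] at h1
  have h2 := Finset.sum_le_card_nsmul _ _ _ hb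
  rw [h1, smul_eq_mul, mul_comm] at h2
  exact absurd h2 (not_le.mpr h)

/-- In a group without involutions, cells are few. -/
lemma two_q_le (h2 : ∀ a : G, 2 • a = 0 → a = 0) (X : Finset G) (h0 : 0 ∈ X)
    (hneg : ∀ a ∈ X, -a ∈ X) (S : Multiset G) (hS : ∀ a ∈ S, a ∈ X) :
    2 * q S ≤ X.card + 1 := by
  classical
  have h1 : q S ≤ (X.image AddSubgroup.zmultiples).card := by
    apply Finset.card_le_card
    intro C hC
    simp only [mem_toFinset, mem_map] at hC
    obtain ⟨a, ha, rfl⟩ := hC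
    exact Finset.mem_image_of_mem _ (hS a ha)
  have h3 : (X.image AddSubgroup.zmultiples).card
      ≤ ((X.erase 0).image AddSubgroup.zmultiples).card + 1 := by
    conv_lhs => rw [← Finset.insert_erase h0, Finset.image_insert]
    exact Finset.card_insert_le _ _
  have h4 : 2 * ((X.erase 0).image AddSubgroup.zmultiples).card ≤ (X.erase 0).card := by
    apply Finset.mul_card_image_le_card
    intro C hC
    obtain ⟨a, ha, rfl⟩ := Finset.mem_image.mp hC
    obtain ⟨ha0, haX⟩ := Finset.mem_erase.mp ha
    have hne : a ≠ -a := by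
      intro h
      exact ha0 (h2 a (by rw [two_nsmul]; nth_rewrite 2 [h]; simp))
    rw [← Finset.card_pair hne]
    apply Finset.card_le_card
    intro b hb
    rw [Finset.mem_insert, Finset.mem_singleton] at hb
    rw [Finset.mem_filter]
    rcases hb with rfl | rfl
    · exact ⟨ha, rfl⟩
    · exact ⟨Finset.mem_erase.mpr ⟨neg_ne_zero.mpr ha0, hneg a haX⟩, AddSubgroup.zmultiples_neg⟩
  have h5 := Finset.card_erase_of_mem h0
  have h6 : 0 < X.card := Finset.card_pos.mpr ⟨0, h0⟩
  omega

/-- The pebbling statement for a group. -/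
def QA (G : Type*) [AddCommGroup G] : Prop :=
  ∀ S : Multiset G, Nat.card G ≤ card S → Red S {0}

/-- The two-pebbling statement for a group. -/
def QB (G : Type*) [AddCommGroup G] : Prop :=
  ∀ S : Multiset G, 2 * Nat.card G < card S + q S → Red S (replicate 2 0)

lemma q_le_natCard [Finite G] (S : Multiset G) : q S ≤ Nat.card G := by
  classical
  have := Fintype.ofFinite G
  rw [Nat.card_eq_fintype_card, ← Finset.card_univ]
  refine le_trans (b := (Finset.univ.image AddSubgroup.zmultiples).card) ?_ Finset.card_image_le
  apply Finset.card_le_card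
  intro C hC
  simp only [mem_toFinset, mem_map] at hC
  obtain ⟨a, ha, rfl⟩ := hC
  exact Finset.mem_image_of_mem _ (Finset.mem_univ a)

lemma QB_many [Finite G] (hA : QA G) (hB : QB G) (t : ℕ) (ht : 2 ≤ t) :
    ∀ S : Multiset G, t * Nat.card G < card S + q S → Red S (replicate t 0) := by
  classical
  induction t, ht using Nat.le_induction with
  | base => exact hB
  | succ t ht ih =>
    intro S hS
    obtain ⟨V, hV, hVc, hVq⟩ := exists_section S
    obtain ⟨W, rfl⟩ := Multiset.le_iff_exists_add.mp hV
    have hq := q_le_natCard (V + W)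
    have hN : 2 * Nat.card G ≤ t * Nat.card G := Nat.mul_le_mul_right _ ht
    rw [add_mul, one_mul, card_add] at hS
    obtain ⟨U, hU, hUc⟩ := exists_le_card W (Nat.card G) (by omega)
    obtain ⟨W', rfl⟩ := Multiset.le_iff_exists_add.mp hU
    have h1 := q_mono (Multiset.le_add_right V W')
    rw [card_add] at hS
    have h2 := ih (V + W') (by rw [card_add]; omega)
    have h3 := h2.add_both (hA U hUc.ge)
    rw [replicate_add, replicate_one]
    have h4 : V + (U + W') = V + W' + U := by abel
    rw [h4]
    exact h3

end cells

section product
variable {P H : Type*} [AddCommGroup P] [AddCommGroup H] [Finite P] [Finite H]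

lemma zm_prod_le (hco : (Nat.card P).Coprime (Nat.card H)) {x x' : P} {h h' : H}
    (hx : x' ∈ AddSubgroup.zmultiples x) (hh : h' ∈ AddSubgroup.zmultiples h) :
    (x', h') ∈ AddSubgroup.zmultiples (x, h) := by
  classical
  rw [mem_zmultiples_iff_mem_range_addOrderOf] at hx hh
  simp only [Finset.mem_image, Finset.mem_range] at hx hh
  obtain ⟨m, _, rfl⟩ := hx
  obtain ⟨n, _, rfl⟩ := hh
  obtain ⟨k, hk1, hk2⟩ := Nat.chineseRemainder hco m n
  have e1 : k • x = m • x := by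
    rw [nsmul_eq_nsmul_iff_modEq]
    exact hk1.of_dvd (addOrderOf_dvd_natCard x)
  have e2 : k • h = n • h := by
    rw [nsmul_eq_nsmul_iff_modEq]
    exact hk2.of_dvd (addOrderOf_dvd_natCard h)
  rw [← e1, ← e2]
  exact AddSubgroup.mem_zmultiples_iff.mpr ⟨k, by simp⟩

lemma zm_prod (hco : (Nat.card P).Coprime (Nat.card H)) {x x' : P} {h h' : H}
    (hx : AddSubgroup.zmultiples x = AddSubgroup.zmultiples x')
    (hh : AddSubgroup.zmultiples h = AddSubgroup.zmultiples h') :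
    AddSubgroup.zmultiples (x, h) = AddSubgroup.zmultiples (x', h') := by
  apply le_antisymm
  · rw [AddSubgroup.zmultiples_le]
    apply zm_prod_le hco
    · rw [← hx]; exact AddSubgroup.mem_zmultiples x
    · rw [← hh]; exact AddSubgroup.mem_zmultiples h
  · rw [AddSubgroup.zmultiples_le]
    apply zm_prod_le hco
    · rw [hx]; exact AddSubgroup.mem_zmultiples x'
    · rw [hh]; exact AddSubgroup.mem_zmultiples h'

lemma zm_nsmul {P : Type*} [AddCommGroup P] {n : ℕ} (hn : n.Coprime (Nat.card P)) (a : P) :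
    AddSubgroup.zmultiples (n • a) = AddSubgroup.zmultiples a := by
  apply le_antisymm
  · rw [AddSubgroup.zmultiples_le]
    exact AddSubgroup.nsmul_mem _ (AddSubgroup.mem_zmultiples a) n
  · rw [AddSubgroup.zmultiples_le]
    obtain ⟨u, v, huv⟩ := Nat.isCoprime_iff_coprime.mpr hn
    refine AddSubgroup.mem_zmultiples_iff.mpr ⟨u, ?_⟩
    have : (u * (n : ℤ) + v * (Nat.card P : ℤ)) • a = a := by rw [huv, one_smul]
    rw [add_smul, mul_smul, mul_smul, natCast_zsmul, natCast_zsmul, card_nsmul_eq_zero',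
      smul_zero, add_zero] at this
    exact this

lemma lift (hco : (Nat.card P).Coprime (Nat.card H)) (x : P) {s t : Multiset H} (h : Red s t) :
    Red (s.map fun a => (x, a)) (t.map fun a => (x, a)) := by
  refine Red.mapFun (fun a => (x, a)) (fun a b hab => zm_prod hco rfl hab) ?_ h
  intro p hp a
  by_cases hd : p ∣ Nat.card P
  · have h1 : p.Coprime (Nat.card H) := Nat.Coprime.coprime_dvd_left hd hco
    refine (Red.le (t := {(x, a)}) ?_).trans (Red.cell (zm_prod hco rfl (zm_nsmul h1 a).symm))
    rw [singleton_le, mem_replicate]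
    exact ⟨hp.ne_zero, rfl⟩
  · have h1 : p.Coprime (Nat.card P) := (hp.coprime_iff_not_dvd).mpr hd
    refine (Red.mul p hp (x, a)).trans (Red.cell ?_)
    exact zm_prod hco (zm_nsmul h1 x) rfl

lemma mv1 (hco : (Nat.card P).Coprime (Nat.card H)) (p : ℕ) (hp : p.Prime) (x : P) (j : ℕ) :
    ∀ S : Multiset H, p * j + (p - 1) * q S < card S + p →
    ∃ V S' : Multiset H, card V = j ∧ card S' + p * j = card S ∧
      Red (S.map fun a => (x, a)) ((S'.map fun a => (x, a)) + V.map fun a => (p • x, a)) := by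
  induction j with
  | zero => intro S _; exact ⟨0, S, by simp, by simp, by simpa using Red.refl _⟩
  | succ j ih =>
    intro S hS
    rw [mul_add, mul_one] at hS
    obtain ⟨U, a, hU, hUc, ha⟩ := exists_cell S p (by omega)
    obtain ⟨W, rfl⟩ := Multiset.le_iff_exists_add.mp hU
    have h1 : (p - 1) * q W ≤ (p - 1) * q (U + W) :=
      Nat.mul_le_mul_left _ (q_mono (Multiset.le_add_left W U))
    rw [card_add] at hS
    obtain ⟨V, S', hV, hS', hR⟩ := ih W (by omega)
    refine ⟨p • a ::ₘ V, S', by rw [card_cons, hV], by rw [card_add, mul_add]; omega, ?_⟩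
    have h2 : Red (U.map fun a => (x, a)) {(p • x, p • a)} := by
      refine Red.trans ?_ (Red.mul p hp (x, a))
      have h3 := Red.map_cells U (fun b => (x, b)) (fun _ => (x, a))
        fun b hb => zm_prod hco rfl (ha b hb)
      rwa [map_const', hUc] at h3
    have h4 := h2.add_both hR
    rw [Multiset.map_add, map_cons]
    convert h4 using 1
    rw [← singleton_add]
    abel

lemma mv2 (hco : (Nat.card P).Coprime (Nat.card H)) (p : ℕ) (hp : p.Prime) (x : P) (j : ℕ)
    (S : Multiset H) (hS : p * j + p * q S < card S + p) :
    ∃ V S' : Multiset H, card V = j ∧ card S' + p * j = card S ∧ q S ≤ q S' ∧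
      Red (S.map fun a => (x, a)) ((S'.map fun a => (x, a)) + V.map fun a => (p • x, a)) := by
  obtain ⟨T, hT, hTc, hTq⟩ := exists_section S
  obtain ⟨W, rfl⟩ := Multiset.le_iff_exists_add.mp hT
  have h1 : (p - 1) * q W ≤ (p - 1) * q (T + W) :=
      Nat.mul_le_mul_left _ (q_mono (Multiset.le_add_left W T))
  have h2 : p * q (T + W) = (p - 1) * q (T + W) + q (T + W) := by
    obtain ⟨r, hr⟩ : ∃ r, p = r + 1 := ⟨p - 1, by have := hp.pos; omega⟩
    rw [hr]; simp; ring
  rw [card_add] at hS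
  obtain ⟨V, S', hV, hS', hR⟩ := mv1 hco p hp x j W (by omega)
  refine ⟨V, T + S', hV, by rw [card_add, card_add]; omega, ?_, ?_⟩
  · rw [← hTq]; exact q_mono (Multiset.le_add_right T S')
  · rw [Multiset.map_add, Multiset.map_add, add_assoc]
    exact (Red.refl _).add_both hR

lemma leaf (hco : (Nat.card P).Coprime (Nat.card H)) (p : ℕ) (hp : p.Prime) (x : P) (k : ℕ)
    (hk : 1 ≤ k) (hx : p ^ k • x = 0) (hA : QA H) (hB : QB H) (t : ℕ) (ht : 1 ≤ t)
    (S : Multiset H) (hS : t * p ^ k * Nat.card H < card S + q S) :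
    Red (S.map fun a => (x, a)) (replicate t 0) := by
  have h2 : 2 ≤ t * p ^ k := by
    have : p ^ 1 ≤ p ^ k := Nat.pow_le_pow_right hp.pos hk
    have := hp.two_le
    nlinarith
  have h1 := lift hco x (QB_many hA hB (t * p ^ k) h2 S hS)
  refine h1.trans ?_
  rw [map_replicate]
  have h3 := (Red.pow p hp k (x, (0 : H))).replicate t
  rw [nsmul_replicate] at h3
  convert h3 using 2
  simp only [Prod.smul_mk, hx, smul_zero]
  rfl

end product

section tree
variable {P : Type*} [AddCommGroup P] [Finite P]

open Classical in
lemma card_gens (x : P) (Y : Finset P) (hY : ∀ z ∈ AddSubgroup.zmultiples x, z ∈ Y) :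
    (Y.filter fun y => AddSubgroup.zmultiples y = AddSubgroup.zmultiples x).card
      = (addOrderOf x).totient := by
  rw [Nat.totient_eq_card_coprime]
  symm
  have hpos : 0 < addOrderOf x := addOrderOf_pos x
  have hgen : ∀ m : ℕ, AddSubgroup.zmultiples (m • x) = AddSubgroup.zmultiples x ↔
      (addOrderOf x).Coprime m := by
    intro m
    have hle : AddSubgroup.zmultiples (m • x) ≤ AddSubgroup.zmultiples x := by
      rw [AddSubgroup.zmultiples_le]
      exact AddSubgroup.nsmul_mem _ (AddSubgroup.mem_zmultiples x) m
    have ho : addOrderOf (m • x) = addOrderOf x / (addOrderOf x).gcd m := addOrderOf_nsmul x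
    constructor
    · intro h
      have h1 : addOrderOf (m • x) = addOrderOf x := by
        rw [← Nat.card_zmultiples, h, Nat.card_zmultiples]
      rw [h1] at ho
      have h2 := Nat.div_mul_cancel (Nat.gcd_dvd_left (addOrderOf x) m)
      rw [← ho] at h2
      exact Nat.eq_of_mul_eq_mul_left hpos (by rw [h2, mul_one])
    · intro h
      apply AddSubgroup.eq_of_le_of_card_ge hle
      rw [Nat.card_zmultiples, Nat.card_zmultiples, ho, h, Nat.div_one]
  refine Finset.card_bij (fun m _ => m • x) ?_ ?_ ?_
  · intro m hm
    rw [Finset.mem_filter] at hm ⊢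
    exact ⟨hY _ (AddSubgroup.nsmul_mem _ (AddSubgroup.mem_zmultiples x) m), (hgen m).mpr hm.2⟩
  · intro m hm n hn h
    rw [Finset.mem_filter, Finset.mem_range] at hm hn
    exact nsmul_injOn_Iio_addOrderOf hm.1 hn.1 h
  · intro y hy
    rw [Finset.mem_filter] at hy
    have h1 : y ∈ AddSubgroup.zmultiples x := by
      rw [← hy.2]; exact AddSubgroup.mem_zmultiples y
    rw [mem_zmultiples_iff_mem_range_addOrderOf] at h1
    simp only [Finset.mem_image] at h1
    obtain ⟨m, hm, rfl⟩ := h1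
    exact ⟨m, Finset.mem_filter.mpr ⟨hm, (hgen m).mp hy.2⟩, rfl⟩

lemma exists_max (Y : Finset P) (z : P) (hz : z ∈ Y) :
    ∃ y ∈ Y, z ∈ AddSubgroup.zmultiples y ∧ ∀ y' ∈ Y, y ∈ AddSubgroup.zmultiples y' →
      AddSubgroup.zmultiples y' = AddSubgroup.zmultiples y := by
  classical
  obtain ⟨y, hy, hmax⟩ := Finset.exists_max_image
    (Y.filter fun y => z ∈ AddSubgroup.zmultiples y) addOrderOf
    ⟨z, Finset.mem_filter.mpr ⟨hz, AddSubgroup.mem_zmultiples z⟩⟩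
  rw [Finset.mem_filter] at hy
  refine ⟨y, hy.1, hy.2, ?_⟩
  intro y' hy' hyy'
  have hle : AddSubgroup.zmultiples y ≤ AddSubgroup.zmultiples y' := by
    rwa [AddSubgroup.zmultiples_le]
  symm
  apply AddSubgroup.eq_of_le_of_card_ge hle
  rw [Nat.card_zmultiples, Nat.card_zmultiples]
  exact hmax y' (Finset.mem_filter.mpr ⟨hy', hle hy.2⟩)

lemma addOrderOf_le_card (Y : Finset P) (x : P) (hY : ∀ z ∈ AddSubgroup.zmultiples x, z ∈ Y) :
    addOrderOf x ≤ Y.card := by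
  classical
  have := Fintype.ofFinite (AddSubgroup.zmultiples x)
  rw [← Nat.card_zmultiples, Nat.card_eq_fintype_card, ← Finset.card_univ]
  exact Finset.card_le_card_of_injOn (fun z => (z : P)) (fun z _ => hY z z.2)
    (fun a _ b _ h => Subtype.ext h)

open Classical in
lemma leaf_exists (p : ℕ) (hp : p.Prime) (hP : ∀ x : P, ∃ k, addOrderOf x = p ^ k)
    (Y : Finset P) (h0 : 0 ∈ Y) (hY : ∀ y ∈ Y, ∀ z ∈ AddSubgroup.zmultiples y, z ∈ Y)
    (hne : ∃ y ∈ Y, y ≠ 0) :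
    ∃ (x : P) (k : ℕ) (Y' : Finset P), x ∈ Y ∧ addOrderOf x = p ^ (k + 1) ∧
      Y' = Y.filter (fun y => AddSubgroup.zmultiples y ≠ AddSubgroup.zmultiples x) ∧
      Y'.card + p ^ k * (p - 1) = Y.card ∧ (Y'.card = p ^ k ∨ p ^ (k + 1) ≤ Y'.card) ∧
      0 ∈ Y' ∧ p • x ∈ Y' ∧ (∀ y ∈ Y', ∀ z ∈ AddSubgroup.zmultiples y, z ∈ Y') := by
  set Mx := Y.filter (fun x => x ≠ 0 ∧ ∀ y' ∈ Y, x ∈ AddSubgroup.zmultiples y' →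
      AddSubgroup.zmultiples y' = AddSubgroup.zmultiples x) with hMx
  have hup : ∀ z ∈ Y, z ≠ 0 → ∃ y ∈ Mx, z ∈ AddSubgroup.zmultiples y := by
    intro z hz hz0
    obtain ⟨y, hy, hzy, hm⟩ := exists_max Y z hz
    refine ⟨y, Finset.mem_filter.mpr ⟨hy, ?_, hm⟩, hzy⟩
    rintro rfl
    rw [AddSubgroup.zmultiples_zero_eq_bot, AddSubgroup.mem_bot] at hzy
    exact hz0 hzy
  obtain ⟨y0, hy0, hy00⟩ := hne
  obtain ⟨y1, hy1, _⟩ := hup y0 hy0 hy00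
  obtain ⟨x, hx, hmin⟩ := Finset.exists_min_image Mx addOrderOf ⟨y1, hy1⟩
  obtain ⟨hxY, hx0, hxm⟩ := Finset.mem_filter.mp hx
  obtain ⟨k', hk'⟩ := hP x
  obtain ⟨k, rfl⟩ : ∃ k, k' = k + 1 := by
    cases k' with
    | zero =>
      rw [pow_zero, AddMonoid.addOrderOf_eq_one_iff] at hk'
      exact absurd hk' hx0
    | succ k => exact ⟨k, rfl⟩
  have hcard : (Y.filter (fun y => AddSubgroup.zmultiples y ≠ AddSubgroup.zmultiples x)).card
      + p ^ k * (p - 1) = Y.card := by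
    have h1 := card_gens x Y (hY x hxY)
    rw [hk', Nat.totient_prime_pow_succ hp] at h1
    rw [← h1, add_comm]
    exact Finset.card_filter_add_card_filter_not _
  have hclosed : ∀ y ∈ Y.filter (fun y => AddSubgroup.zmultiples y ≠ AddSubgroup.zmultiples x),
      ∀ z ∈ AddSubgroup.zmultiples y,
      z ∈ Y.filter (fun y => AddSubgroup.zmultiples y ≠ AddSubgroup.zmultiples x) := by
    intro y hy z hz
    rw [Finset.mem_filter] at hy ⊢
    refine ⟨hY y hy.1 z hz, fun h => hy.2 ?_⟩
    apply hxm y hy.1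
    have h1 : AddSubgroup.zmultiples z ≤ AddSubgroup.zmultiples y := by
      rwa [AddSubgroup.zmultiples_le]
    rw [h] at h1
    exact h1 (AddSubgroup.mem_zmultiples x)
  have hpow : p ^ k + p ^ k * (p - 1) = p ^ (k + 1) := by
    have := hp.pos
    obtain ⟨r, rfl⟩ : ∃ r, p = r + 1 := ⟨p - 1, by omega⟩
    simp; ring
  refine ⟨x, k, _, hxY, hk', rfl, hcard, ?_, ?_, ?_, hclosed⟩
  · by_cases hall : ∀ z ∈ Y, z ∈ AddSubgroup.zmultiples x
    · left
      have h1 : Y.card ≤ addOrderOf x := by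
        have := Fintype.ofFinite (AddSubgroup.zmultiples x)
        rw [← Nat.card_zmultiples, Nat.card_eq_fintype_card, ← Fintype.card_coe]
        exact Fintype.card_le_of_injective (fun z : Y => (⟨z, hall z z.2⟩ : AddSubgroup.zmultiples x))
          (fun a b h => Subtype.ext (by simpa using h))
      have h2 := addOrderOf_le_card Y x (hY x hxY)
      rw [hk'] at h1 h2
      omega
    · right
      push Not at hall
      obtain ⟨z, hz, hzx⟩ := hall
      obtain ⟨y, hy, hzy⟩ := hup z hz (by rintro rfl; exact hzx (AddSubgroup.zero_mem _))
      rw [← hk']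
      refine (hmin y hy).trans (addOrderOf_le_card _ y (hclosed y ?_))
      rw [Finset.mem_filter]
      refine ⟨(Finset.mem_filter.mp hy).1, fun h => hzx ?_⟩
      rwa [← h]
  · rw [Finset.mem_filter]
    refine ⟨h0, fun h => hx0 ?_⟩
    have := AddSubgroup.mem_zmultiples x
    rw [← h, AddSubgroup.zmultiples_zero_eq_bot, AddSubgroup.mem_bot] at this
    exact this
  · rw [Finset.mem_filter]
    refine ⟨hY x hxY _ (AddSubgroup.nsmul_mem _ (AddSubgroup.mem_zmultiples x) p), fun h => ?_⟩
    have h1 : addOrderOf (p • x) = addOrderOf x := by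
        rw [← Nat.card_zmultiples, h, Nat.card_zmultiples]
    rw [addOrderOf_nsmul, hk', Nat.gcd_eq_right (dvd_pow_self p (by omega)), pow_succ,
      Nat.mul_div_cancel _ hp.pos] at h1
    have h2 : 0 < p ^ k := pow_pos hp.pos k
    have h3 := hp.two_le
    nlinarith

end tree

section arith

lemma arithA {p W M a b c : ℕ} (hp : 2 ≤ p) (h : W + (p - 1) * M ≤ a + b) (hb : b + c ≤ p * M)
    (ha : a < W) : p * (W - a) + (p - 1) * c < b + p := by
  obtain ⟨r, rfl⟩ : ∃ r, p = r + 1 := ⟨p - 1, by omega⟩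
  obtain ⟨d, rfl⟩ : ∃ d, W = a + d := ⟨W - a, by omega⟩
  simp only [Nat.add_sub_cancel, Nat.add_sub_cancel_left] at *
  have h1 : d + r * M ≤ b := by omega
  nlinarith

lemma arithB2 {p W M a b c e j : ℕ} (hp : 2 ≤ p)
    (h : 2 * (W + (p - 1) * M) < a + b + e + c) (hb : b + c ≤ p * M) (hc : c ≤ M)
    (hj : a + e + j = 2 * W + 1) : p * j + (p - 1) * c < b + p := by
  obtain ⟨r, rfl⟩ : ∃ r, p = r + 1 := ⟨p - 1, by omega⟩
  simp only [Nat.add_sub_cancel] at *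
  have h1 : j + 2 * (r * M) ≤ b + c := by omega
  nlinarith

lemma arithB3 {p M b c j : ℕ} (hp : 2 ≤ p) (hc : 2 * c ≤ M + 1) (h : p * M + p * j < b + c) :
    p * j + p * c < b + p := by
  nlinarith

lemma arithB4 {p W M a b c e : ℕ} (hp : 2 ≤ p) (hM : 1 ≤ M)
    (h : 2 * (W + (p - 1) * M) < a + b + e + c) (hb : b + c ≤ 2 * (p * M)) (hea : e ≤ a)
    (ha : a < W) (hWM : W = M ∨ p * M ≤ W) (he : p = 2 ∨ 2 * e ≤ W + 1) :
    p * M + p * (W - a) < b + c := by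
  by_contra hcon
  obtain ⟨r, rfl⟩ : ∃ r, p = r + 2 := ⟨p - 2, by omega⟩
  obtain ⟨d, rfl⟩ : ∃ d, W = a + d := ⟨W - a, by omega⟩
  have e1 : r + 2 - 1 = r + 1 := by omega
  simp only [Nat.add_sub_cancel_left, e1] at *
  push Not at hcon
  rcases hWM with hWM | hWM
  · subst hWM
    nlinarith
  · rcases he with he | he
    · have : r = 0 := by omega
      subst this
      nlinarith
    · rcases Nat.eq_zero_or_pos r with rfl | hr
      · nlinarith
      · have h3 : 3 * M ≤ a + d := by nlinarith
        have h5 : a + d + 1 ≤ M + e := by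
          by_contra hlt
          push Not at hlt
          have h6 : 2 * (a + d) + 1 ≤ a + e + 2 * M := by nlinarith
          nlinarith
        omega

end arith

section main
variable {P H : Type*} [AddCommGroup P] [AddCommGroup H] [Finite P] [Finite H]

lemma tree_main (hco : (Nat.card P).Coprime (Nat.card H)) (p : ℕ) (hp : p.Prime)
    (hP : ∀ x : P, ∃ k, addOrderOf x = p ^ k) (hH2 : ∀ a : H, 2 • a = 0 → a = 0)
    (hP2 : p = 2 ∨ ∀ a : P, 2 • a = 0 → a = 0) (hA : QA H) (hB : QB H) (n : ℕ) :
    ∀ Y : Finset P, Y.card = n → 0 ∈ Y → (∀ y ∈ Y, ∀ z ∈ AddSubgroup.zmultiples y, z ∈ Y) →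
    ∀ S : Multiset (P × H), (∀ s ∈ S, s.1 ∈ Y) →
      (Y.card * Nat.card H ≤ card S → Red S {0}) ∧
      (2 * (Y.card * Nat.card H) < card S + q S → Red S (replicate 2 0)) := by
  classical
  induction n using Nat.strong_induction_on with
  | _ n ih =>
  intro Y hYn h0 hY S hS
  have hN : 1 ≤ Nat.card H := Nat.card_pos
  by_cases hne : ∃ y ∈ Y, y ≠ 0
  swap
  · -- base case
    push Not at hne
    have hY0 : Y = {0} := by
      ext y
      rw [Finset.mem_singleton]
      exact ⟨hne y, by rintro rfl; exact h0⟩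
    have hSS : S = (S.map Prod.snd).map fun a => ((0 : P), a) := by
      rw [Multiset.map_map]
      conv_lhs => rw [← Multiset.map_id S]
      apply map_congr rfl
      intro s hs
      exact Prod.ext (hne _ (hS s hs)) rfl
    have hq : q S ≤ q (S.map Prod.snd) := by
      conv_lhs => rw [hSS]
      rw [Multiset.map_map]
      exact q_le_of_map S _ _ fun a _ b _ h => zm_prod hco rfl h
    rw [hY0, Finset.card_singleton, one_mul]
    constructor
    · intro h
      rw [hSS]
      have := lift hco (0 : P) (hA (S.map Prod.snd) (by rwa [card_map]))
      rwa [map_singleton] at this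
    · intro h
      rw [hSS]
      have := lift hco (0 : P) (hB (S.map Prod.snd) (by rw [card_map]; omega))
      rwa [map_replicate] at this
  · obtain ⟨x, k, Y', hxY, hxo, hY', hcard, hor, h0', hpx, hcl⟩ := leaf_exists p hp hP Y h0 hY hne
    have hp2 := hp.two_le
    have hpk : 1 ≤ p ^ k := Nat.one_le_pow _ _ hp.pos
    have hlt : Y'.card < n := by
      have : 1 ≤ p ^ k * (p - 1) := Nat.mul_pos hpk (by omega)
      omega
    have IH := ih _ hlt Y' rfl h0' hcl
    have hpkx : p ^ (k + 1) • x = 0 := by rw [← hxo]; exact addOrderOf_nsmul_eq_zero x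
    obtain ⟨Sa, hSa⟩ : ∃ Sa, Sa = S.filter fun s => s.1 ∈ Y' := ⟨_, rfl⟩
    obtain ⟨Sb, hSb⟩ : ∃ Sb, Sb = S.filter fun s => ¬ s.1 ∈ Y' := ⟨_, rfl⟩
    have hSab : S = Sa + Sb := by rw [hSa, hSb, filter_add_not]
    have hSaY : ∀ s ∈ Sa, s.1 ∈ Y' := fun s hs => by rw [hSa] at hs; exact (mem_filter.mp hs).2
    have hSbx : ∀ s ∈ Sb, AddSubgroup.zmultiples s.1 = AddSubgroup.zmultiples x := by
      intro s hs
      rw [hSb, mem_filter] at hs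
      by_contra hc
      exact hs.2 (hY' ▸ Finset.mem_filter.mpr ⟨hS s hs.1, hc⟩)
    obtain ⟨Sh, hSh⟩ : ∃ Sh, Sh = Sb.map Prod.snd := ⟨_, rfl⟩
    have hbc : card Sh = card Sb := by rw [hSh, card_map]
    have hbR : Red Sb (Sh.map fun a => (x, a)) := by
      have := Red.map_cells Sb id (fun s => (x, s.2)) fun s hs => zm_prod hco (hSbx s hs) rfl
      rw [Multiset.map_id] at this
      rw [hSh, Multiset.map_map]
      exact this
    have hqb : q Sb ≤ q Sh := by
      have := q_le_of_map Sb id Prod.snd fun a ha b hb h =>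
        zm_prod hco ((hSbx a ha).trans (hSbx b hb).symm) h
      rwa [Multiset.map_id, ← hSh] at this
    have hqS : q S ≤ q Sa + q Sh := by
      rw [hSab]; exact (q_add_le Sa Sb).trans (by omega)
    have hcS : card S = card Sa + card Sh := by rw [hSab, card_add, hbc]
    -- cell bounds
    have hc2 : 2 * q Sh ≤ Nat.card H + 1 := by
      have := Fintype.ofFinite H
      have h1 := two_q_le hH2 Finset.univ (Finset.mem_univ _) (fun a _ => Finset.mem_univ _) Sh
        fun a _ => Finset.mem_univ _
      rwa [Finset.card_univ, ← Nat.card_eq_fintype_card] at h1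
    have he2 : p = 2 ∨ 2 * q Sa ≤ Y'.card * Nat.card H + 1 := by
      rcases hP2 with h | hP2
      · exact Or.inl h
      right
      have := Fintype.ofFinite H
      have h1 := two_q_le (G := P × H) (fun a ha => Prod.ext (hP2 _ (congrArg Prod.fst ha))
        (hH2 _ (congrArg Prod.snd ha))) (Y' ×ˢ Finset.univ)
        (Finset.mem_product.mpr ⟨h0', Finset.mem_univ _⟩)
        (fun a ha => Finset.mem_product.mpr ⟨hcl a.1 (Finset.mem_product.mp ha).1 _
          (AddSubgroup.neg_mem _ (AddSubgroup.mem_zmultiples _)), Finset.mem_univ _⟩) Sa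
        fun a ha => Finset.mem_product.mpr ⟨hSaY a ha, Finset.mem_univ _⟩
      rwa [Finset.card_product, Finset.card_univ, ← Nat.card_eq_fintype_card] at h1
    have hea := q_le_card Sa
    obtain ⟨M, hM⟩ : ∃ M, M = p ^ k * Nat.card H := ⟨_, rfl⟩
    obtain ⟨W, hW⟩ : ∃ W, W = Y'.card * Nat.card H := ⟨_, rfl⟩
    have hNM : Nat.card H ≤ M := by rw [hM]; exact Nat.le_mul_of_pos_left _ hpk
    have hYN : Y.card * Nat.card H = W + (p - 1) * M := by
      rw [← hcard, hM, hW]; ring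
    have hpM : p ^ (k + 1) * Nat.card H = p * M := by rw [hM]; ring
    have hWM : W = M ∨ p * M ≤ W := by
      rcases hor with h | h
      · left; rw [hW, hM, h]
      · right; rw [← hpM, hW]; exact Nat.mul_le_mul_right _ h
    rw [← hW] at IH he2
    have leaf1 : ∀ T : Multiset H, p * M < card T + q T →
        Red (T.map fun a => (x, a)) {0} := by
      intro T hT
      have := leaf hco p hp x (k + 1) (by omega) hpkx hA hB 1 le_rfl T (by rw [one_mul, hpM]; exact hT)
      rwa [replicate_one] at this
    have hVY : ∀ V : Multiset H, ∀ s ∈ Sa + V.map (fun a => (p • x, a)), s.1 ∈ Y' := by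
      intro V s hs
      rcases mem_add.mp hs with hs | hs
      · exact hSaY s hs
      · obtain ⟨a, _, rfl⟩ := mem_map.mp hs
        exact hpx
    have move : ∀ j, p * j + (p - 1) * q Sh < card Sh + p → ∃ V : Multiset H, card V = j ∧
        Red S (Sa + V.map fun a => (p • x, a)) := by
      intro j hj
      obtain ⟨V, S', hV, _, hR⟩ := mv1 hco p hp x j Sh hj
      refine ⟨V, hV, ?_⟩
      rw [hSab]
      exact (Red.refl Sa).add_both (hbR.trans (hR.trans (Red.le (Multiset.le_add_left _ _))))
    have dropA : Red S Sa := by rw [hSab]; exact Red.le (Multiset.le_add_right _ _)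
    have dropB : Red S (Sh.map fun a => (x, a)) := by
      rw [hSab]; exact (Red.le (Multiset.le_add_left _ _)).trans hbR
    rw [hYN, hcS]
    constructor
    · intro h
      by_cases hb : p * M < card Sh + q Sh
      · exact dropB.trans (leaf1 Sh hb)
      push Not at hb
      by_cases ha : W ≤ card Sa
      · exact dropA.trans ((IH Sa hSaY).1 ha)
      push Not at ha
      obtain ⟨V, hV, hR⟩ := move _ (arithA hp2 h hb ha)
      refine hR.trans ((IH _ (hVY V)).1 ?_)
      rw [card_add, card_map, hV]
      omega
    · intro h
      have h' : 2 * (W + (p - 1) * M) < card Sa + card Sh + q Sa + q Sh := by omega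
      by_cases hb2 : 2 * (p * M) < card Sh + q Sh
      · refine dropB.trans ?_
        exact leaf hco p hp x (k + 1) (by omega) hpkx hA hB 2 (by omega) Sh
          (by rw [mul_assoc, hpM]; exact hb2)
      push Not at hb2
      by_cases hb : p * M < card Sh + q Sh
      · by_cases ha : W ≤ card Sa
        · have h1 := ((IH Sa hSaY).1 ha).add_both (hbR.trans (leaf1 Sh hb))
          rw [hSab]
          exact h1
        push Not at ha
        have h4 := arithB4 hp2 (by omega) h' hb2 hea ha hWM he2
        obtain ⟨V, S', hV, hS', hqS', hR⟩ := mv2 hco p hp x _ Sh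
          (arithB3 hp2 (by omega) h4)
        have h1 : Red (S'.map fun a => (x, a)) {0} := leaf1 S' (by omega)
        have h2 : Red (Sa + V.map fun a => (p • x, a)) {0} := by
          apply (IH _ (hVY V)).1
          rw [card_add, card_map, hV]
          omega
        rw [hSab]
        refine ((Red.refl Sa).add_both (hbR.trans hR)).trans ?_
        have h3 := h1.add_both h2
        rw [add_left_comm]
        exact h3
      · push Not at hb
        by_cases hj : 2 * W < card Sa + q Sa
        · exact dropA.trans ((IH Sa hSaY).2 hj)
        push Not at hj
        obtain ⟨V, hV, hR⟩ := move _ (arithB2 (j := 2 * W + 1 - card Sa - q Sa) hp2 h' hb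
          (by omega) (by omega))
        refine hR.trans ((IH _ (hVY V)).2 ?_)
        have := q_mono (Multiset.le_add_right Sa (V.map fun a => (p • x, a)))
        rw [card_add, card_map, hV]
        omega

lemma prod_main (hco : (Nat.card P).Coprime (Nat.card H)) (p : ℕ) (hp : p.Prime)
    (hP : ∀ x : P, ∃ k, addOrderOf x = p ^ k) (hH2 : ∀ a : H, 2 • a = 0 → a = 0)
    (hP2 : p = 2 ∨ ∀ a : P, 2 • a = 0 → a = 0) (hA : QA H) (hB : QB H) :
    QA (P × H) ∧ QB (P × H) := by
  have := Fintype.ofFinite P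
  have key := fun S => tree_main hco p hp hP hH2 hP2 hA hB _ Finset.univ rfl (Finset.mem_univ _)
    (fun _ _ _ _ => Finset.mem_univ _) S (fun _ _ => Finset.mem_univ _)
  rw [Finset.card_univ, ← Nat.card_eq_fintype_card, ← Nat.card_prod] at key
  exact ⟨fun S => (key S).1, fun S => (key S).2⟩

lemma transport {G : Type*} [AddCommGroup G] (e : P × H ≃+ G)
    (h : QA (P × H) ∧ QB (P × H)) : QA G ∧ QB G := by
  have hc : Nat.card (P × H) = Nat.card G := Nat.card_congr e.toEquiv
  have hm : ∀ S : Multiset G, (S.map e.symm).map (e : P × H →+ G) = S := by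
    intro S; rw [Multiset.map_map]; simp
  constructor
  · intro S hS
    have h1 := (h.1 (S.map e.symm) (by rwa [card_map, hc])).mapHom (e : P × H →+ G)
    rw [hm] at h1
    simpa using h1
  · intro S hS
    have hq : q S ≤ q (S.map e.symm) := by
      have := q_le_of_map S id e.symm fun a _ b _ hab => by
        have := congrArg (AddSubgroup.map (e : P × H →+ G)) hab
        simpa [AddMonoidHom.map_zmultiples] using this
      rwa [Multiset.map_id] at this
    have h1 := (h.2 (S.map e.symm) (by rw [card_map, hc]; omega)).mapHom (e : P × H →+ G)
    rw [hm] at h1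
    simpa using h1

end main

lemma two_torsion {G : Type*} [AddCommGroup G] [Finite G] (h : ¬ 2 ∣ Nat.card G) (a : G)
    (ha : 2 • a = 0) : a = 0 := by
  have h1 := addOrderOf_dvd_of_nsmul_eq_zero ha
  have h2 := addOrderOf_dvd_natCard a
  rcases (Nat.dvd_prime Nat.prime_two).mp h1 with h3 | h3
  · exact AddMonoid.addOrderOf_eq_one_iff.mp h3
  · rw [h3] at h2
    exact absurd h2 h

universe u

lemma all_main (n : ℕ) : ∀ (G : Type u) [AddCommGroup G] [Finite G], Nat.card G = n →
    QA G ∧ QB G := by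
  induction n using Nat.strong_induction_on with
  | _ n ih =>
  intro G _ _ hn
  have hpos : 0 < Nat.card G := Nat.card_pos
  by_cases h1 : Nat.card G = 1
  · have hsub : Subsingleton G := (Nat.card_eq_one_iff_unique.mp h1).1
    have key : ∀ (m : ℕ) (S : Multiset G), m ≤ card S → Red S (replicate m 0) := by
      intro m S hS
      apply Red.le
      have : S = replicate (card S) 0 := by
        rw [eq_replicate]
        exact ⟨rfl, fun b _ => Subsingleton.elim _ _⟩
      rw [this]
      exact (replicate_le_replicate _).mpr hS
    constructor
    · intro S hS
      have := key 1 S (by omega)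
      rwa [replicate_one] at this
    · intro S hS
      have := q_le_natCard S
      exact key 2 S (by omega)
  · obtain ⟨p, hpdef⟩ : ∃ p, p = (Nat.card G).minFac := ⟨_, rfl⟩
    have hp : p.Prime := hpdef ▸ Nat.minFac_prime h1
    have hpd : p ∣ Nat.card G := hpdef ▸ Nat.minFac_dvd _
    obtain ⟨k, m, hpm, hkm⟩ := Nat.exists_eq_pow_mul_and_not_dvd hpos.ne' p hp.ne_one
    have hcop : Nat.Coprime (p ^ k) m := ((hp.coprime_iff_not_dvd).mpr hpm).pow_left k
    let A : Submodule ℤ G := Submodule.torsionBy ℤ G ((p ^ k : ℕ) : ℤ)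
    let B : Submodule ℤ G := Submodule.torsionBy ℤ G (m : ℤ)
    have memA : ∀ a : G, a ∈ A ↔ p ^ k • a = 0 := by
      intro a
      rw [Submodule.mem_torsionBy_iff, natCast_zsmul]
    have memB : ∀ a : G, a ∈ B ↔ m • a = 0 := by
      intro a
      rw [Submodule.mem_torsionBy_iff, natCast_zsmul]
    obtain ⟨u, v, huv⟩ := Nat.isCoprime_iff_coprime.mpr hcop
    have hcompl : IsCompl A B := by
      constructor
      · rw [Submodule.disjoint_def]
        intro a ha hb
        rw [memA] at ha
        rw [memB] at hb
        have : (u * ((p ^ k : ℕ) : ℤ) + v * (m : ℤ)) • a = a := by rw [huv, one_smul]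
        rw [add_smul, mul_smul, mul_smul, natCast_zsmul, natCast_zsmul, ha, hb] at this
        simpa using this.symm
      · rw [codisjoint_iff, eq_top_iff]
        intro a _
        have : (v * (m : ℤ)) • a + (u * ((p ^ k : ℕ) : ℤ)) • a = a := by
          rw [← add_smul, add_comm, huv, one_smul]
        rw [← this]
        have hz : (p ^ k * m) • a = 0 := by rw [← hkm]; exact card_nsmul_eq_zero'
        refine Submodule.add_mem_sup ?_ ?_
        · rw [memA, mul_smul, natCast_zsmul, smul_comm, smul_smul, hz, smul_zero]
        · rw [memB, mul_smul, natCast_zsmul, smul_comm, smul_smul, mul_comm m, hz, smul_zero]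
    let e : A × B ≃+ G := (Submodule.prodEquivOfIsCompl A B hcompl).toAddEquiv
    have hAB : Nat.card A * Nat.card B = Nat.card G := by
      rw [← Nat.card_prod]; exact Nat.card_congr e.toEquiv
    have hoA : ∀ x : A, ∃ j, addOrderOf x = p ^ j := by
      intro x
      have h2 : p ^ k • x = 0 := Subtype.ext ((memA x).mp x.2)
      obtain ⟨j, _, hj⟩ := (Nat.dvd_prime_pow hp).mp (addOrderOf_dvd_of_nsmul_eq_zero h2)
      exact ⟨j, hj⟩
    have hpB : ¬ p ∣ Nat.card B := by
      intro hd
      have := Fact.mk hp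
      obtain ⟨b, hb⟩ := exists_prime_addOrderOf_dvd_card' p hd
      have h2 : m • b = 0 := Subtype.ext ((memB b).mp b.2)
      have h3 := addOrderOf_dvd_of_nsmul_eq_zero h2
      rw [hb] at h3
      exact hpm h3
    have hcoAB : (Nat.card A).Coprime (Nat.card B) := by
      apply Nat.Coprime.symm
      apply Nat.coprime_of_dvd
      intro l hl hlB hlA
      have := Fact.mk hl
      obtain ⟨a, ha⟩ := exists_prime_addOrderOf_dvd_card' l hlA
      obtain ⟨j, hj⟩ := hoA a
      have h2 : l ∣ p ^ j := by rw [← hj, ha]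
      have h3 := (Nat.prime_dvd_prime_iff_eq hl hp).mp (hl.dvd_of_dvd_pow h2)
      exact hpB (h3 ▸ hlB)
    have hBlt : Nat.card B < n := by
      rw [← hn]
      refine lt_of_le_of_ne (Nat.le_of_dvd hpos ⟨Nat.card A, by rw [← hAB, mul_comm]⟩) ?_
      intro h
      exact hpB (h ▸ hpd)
    have h2G : p = 2 ∨ ¬ 2 ∣ Nat.card G := by
      by_cases h : 2 ∣ Nat.card G
      · left
        rw [hpdef]
        exact (Nat.minFac_eq_two_iff _).mpr h
      · exact Or.inr h
    have h2B : ¬ 2 ∣ Nat.card B := by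
      rcases h2G with h | h
      · rw [← h]; exact hpB
      · intro hd
        exact h (hd.trans ⟨Nat.card A, by rw [← hAB, mul_comm]⟩)
    have h2A : p = 2 ∨ ∀ a : A, 2 • a = 0 → a = 0 := by
      rcases h2G with h | h
      · exact Or.inl h
      · right
        exact two_torsion fun hd => h (hd.trans ⟨Nat.card B, hAB.symm⟩)
    obtain ⟨iA, iB⟩ := ih _ hBlt B rfl
    exact transport e (prod_main hcoAB p hp hoA (two_torsion h2B) h2A iA iB)

end ZSR

/-- Kleitman–Lemke conjecture for abelian groups: for every sequence of |G|
elements of a finite abelian group G there is a nonempty subsequence that sums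
to zero and whose sum of reciprocal element orders is at most 1. -/
theorem zero_sum_reciprocal_orders (G : Type*) [AddCommGroup G] [Fintype G]
    (g : Fin (Fintype.card G) → G) :
    ∃ K : Finset (Fin (Fintype.card G)), K.Nonempty ∧
      (∑ k ∈ K, g k = 0) ∧ (∑ k ∈ K, (1 : ℚ) / (addOrderOf (g k) : ℚ) ≤ 1) := by
  apply ZSR.final
  apply (ZSR.all_main _ G rfl).1
  simp
end

section
/- For any positive integer n, every sequence (a_k), k = 1, ..., n, of n integers contains a nonempty subset K of {1, ..., n} such that ∑_{k ∈ K} a_k ≡ 0 (mod n) and ∑_{k ∈ K} gcd(a_k, n) ≤ n. -/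
namespace KL

/-- Weighted pebbling moves on the divisor lattice. -/
inductive R : Multiset ℕ → Multiset ℕ → Prop
  | refl (s : Multiset ℕ) : R s s
  | trans {a b c : Multiset ℕ} : R a b → R b c → R a c
  | addr {a b : Multiset ℕ} (c : Multiset ℕ) : R a b → R (a + c) (b + c)
  | drop (a : Multiset ℕ) : R a 0
  | move (p d : ℕ) : 0 < p → R (Multiset.replicate p d) {p * d}

theorem R.add {a b c d : Multiset ℕ} (h : R a b) (h' : R c d) : R (a + c) (b + d) := by
  refine (R.addr c h).trans ?_
  rw [add_comm b c, add_comm b d]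
  exact R.addr b h'

theorem R.of_le {a b : Multiset ℕ} (h : b ≤ a) : R a b := by
  obtain ⟨c, rfl⟩ := Multiset.le_iff_exists_add.1 h
  simpa using (R.refl b).add (R.drop c)

theorem R.scale {a b : Multiset ℕ} (c : ℕ) (h : R a b) :
    R (a.map (c * ·)) (b.map (c * ·)) := by
  induction h with
  | refl s => exact R.refl _
  | trans _ _ h1 h2 => exact h1.trans h2
  | addr u _ h => simpa using R.addr _ h
  | drop a => exact R.drop _
  | move p d hp =>
    have := R.move p (c * d) hp
    simpa [Multiset.map_replicate, Nat.mul_left_comm] using this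

theorem R.up {c : Multiset ℕ} {p j m : ℕ} (hp : 0 < p)
    (h : R c (Multiset.replicate (p * j) m)) : R c (Multiset.replicate j (p * m)) := by
  refine h.trans ?_
  clear h
  induction j with
  | zero => exact R.drop _
  | succ j ih =>
    rw [Nat.mul_succ, Multiset.replicate_add, Multiset.replicate_add]
    exact ih.add (R.move p m hp)

theorem exists_sub {α : Type*} (s : Multiset α) (k : ℕ) (h : k ≤ Multiset.card s) :
    ∃ t ≤ s, Multiset.card t = k := by
  induction s using Quotient.inductionOn with
  | h l =>
    refine ⟨(l.take k : List α), ?_, ?_⟩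
    · exact Multiset.coe_le.2 (List.take_sublist k l).subperm
    · simpa using h

/-- number of distinct vertices -/
def q (c : Multiset ℕ) : ℕ := c.toFinset.card

theorem q_mono {a b : Multiset ℕ} (h : a ≤ b) : q a ≤ q b :=
  Finset.card_le_card (Multiset.toFinset_subset.2 (Multiset.subset_of_le h))

theorem q_le_card (c : Multiset ℕ) : q c ≤ Multiset.card c := Multiset.toFinset_card_le c

theorem q_tau {c : Multiset ℕ} {m : ℕ} (hm : 0 < m) (h : ∀ d ∈ c, d ∣ m) :
    q c ≤ m.divisors.card := by
  apply Finset.card_le_card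
  intro d hd
  simp at hd
  simp [h d hd, hm.ne']

theorem tau_bound (m : ℕ) (hm : 0 < m) : 3 * m.divisors.card ≤ 2 * (m + 1) := by
  by_cases h4 : m < 4
  · interval_cases m <;> decide
  have : m.divisors ⊆ insert m (insert (m / 2) (Finset.Icc 1 (m / 3))) := by
    intro d hd
    obtain ⟨⟨e, he⟩, -⟩ := Nat.mem_divisors.1 hd
    simp only [Finset.mem_insert, Finset.mem_Icc]
    have hd0 : 0 < d := Nat.pos_of_mem_divisors hd
    rcases e with _ | _ | _ | e
    · omega
    · left; omega
    · right; left; omega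
    · right; right
      refine ⟨hd0, ?_⟩
      rw [Nat.le_div_iff_mul_le (by norm_num), he]
      nlinarith [Nat.zero_le (d * e)]
  have h1 := Finset.card_le_card this
  have h2 := Finset.card_insert_le m (insert (m / 2) (Finset.Icc 1 (m / 3)))
  have h3 := Finset.card_insert_le (m / 2) (Finset.Icc 1 (m / 3))
  simp only [Nat.card_Icc] at h3
  omega

theorem q_bound {c : Multiset ℕ} {m : ℕ} (hm : 0 < m) (h : ∀ d ∈ c, d ∣ m) :
    3 * q c ≤ 2 * (m + 1) := by
  have := q_tau hm h
  have := tau_bound m hm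
  omega

theorem q_le {c : Multiset ℕ} {m : ℕ} (hm : 0 < m) (h : ∀ d ∈ c, d ∣ m) : q c ≤ m :=
  (q_tau hm h).trans (Nat.card_divisors_le_self m)

def A1 (n : ℕ) : Prop := ∀ c : Multiset ℕ, (∀ d ∈ c, d ∣ n) → n ≤ Multiset.card c → R c {n}
def A2 (n : ℕ) : Prop := ∀ c : Multiset ℕ, (∀ d ∈ c, d ∣ n) →
  2 * n < Multiset.card c + q c → R c (Multiset.replicate 2 n)

theorem Ak {n : ℕ} (hn : 0 < n) (h1 : A1 n) (h2 : A2 n) (k : ℕ) (hk : 2 ≤ k) :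
    ∀ c : Multiset ℕ, (∀ d ∈ c, d ∣ n) →
      k * n < Multiset.card c + q c → R c (Multiset.replicate k n) := by
  induction k, hk using Nat.le_induction with
  | base => exact h2
  | succ k hk ih =>
    intro c hc hlt
    have hqn := q_le hn hc
    have hle : c.dedup ≤ c := Multiset.dedup_le c
    have hcard : Multiset.card c.dedup = q c := rfl
    have hE : Multiset.card (c - c.dedup) = Multiset.card c - q c := by
      rw [Multiset.card_sub hle, hcard]
    obtain ⟨E, hEle, hEc⟩ := exists_sub (c - c.dedup) n (by
      rw [hE]; nlinarith [Nat.sub_add_cancel (q_le_card c)])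
    have hEc' : E ≤ c := hEle.trans (Multiset.sub_le_self _ _)
    have hd : c.dedup ≤ c - E := by
      have : E + c.dedup ≤ c := by
        calc E + c.dedup ≤ (c - c.dedup) + c.dedup := by gcongr
          _ = c := Multiset.sub_add_cancel hle
      exact le_tsub_of_add_le_left this
    have hq : q c ≤ q (c - E) := by
      have := q_mono hd
      simpa [q] using this
    have hr := ih (c - E) (fun d hd => hc d (Multiset.mem_of_le (Multiset.sub_le_self _ _) hd)) (by
      rw [Multiset.card_sub hEc', hEc]
      have : n ≤ Multiset.card c := hEc ▸ Multiset.card_le_card hEc'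
      have := Nat.sub_add_cancel this
      nlinarith)
    have hr1 := h1 E (fun d hd => hc d (Multiset.mem_of_le hEc' hd)) hEc.ge
    have := hr.add hr1
    rw [Multiset.sub_add_cancel hEc'] at this
    rw [Multiset.replicate_add]
    exact this

theorem X1 {p : ℕ} (hp : 0 < p) (t : ℕ) : ∀ c : Multiset ℕ,
    p * t + (p - 1) * q c < Multiset.card c + p →
    ∃ e : Multiset ℕ, Multiset.card e = t ∧ (∀ d ∈ e, d ∈ c) ∧ R c (e.map (p * ·)) := by
  induction t with
  | zero => intro c _; exact ⟨0, by simp, by simp, R.drop _⟩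
  | succ t ih =>
    intro c hc
    have : ∃ d ∈ c.toFinset, p - 1 < c.count d := by
      by_contra! hcon
      have := Finset.sum_le_card_nsmul _ _ _ hcon
      rw [Multiset.toFinset_sum_count_eq] at this
      simp only [smul_eq_mul] at this
      have e : c.toFinset.card = q c := rfl
      rw [e] at this
      nlinarith
    obtain ⟨d, hd, hcount⟩ := this
    have hle : Multiset.replicate p d ≤ c := Multiset.le_count_iff_replicate_le.1 (by omega)
    have hsub : c - Multiset.replicate p d ≤ c := Multiset.sub_le_self _ _
    have hqm := q_mono hsub
    have hcard := Multiset.card_sub hle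
    have hcl := Multiset.card_le_card hle
    rw [Multiset.card_replicate] at hcard hcl
    obtain ⟨e, he, hec, hr⟩ := ih (c - Multiset.replicate p d) (by
      rw [hcard]
      have := Nat.mul_le_mul_left (p - 1) hqm
      have e : p * (t + 1) = p * t + p := by ring
      omega)
    refine ⟨e + {d}, by simp [he], ?_, ?_⟩
    · intro x hx
      rcases Multiset.mem_add.1 hx with hx | hx
      · exact Multiset.mem_of_le hsub (hec x hx)
      · rw [Multiset.mem_singleton.1 hx]; simpa using hd
    · have := hr.add (R.move p d hp)
      rw [Multiset.sub_add_cancel hle] at this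
      simpa using this

theorem X2 {p : ℕ} (hp : 0 < p) (t : ℕ) (c : Multiset ℕ)
    (h : p * t + p * q c < Multiset.card c + p) :
    ∃ e c' : Multiset ℕ, Multiset.card e = t ∧ (∀ d ∈ e, d ∈ c) ∧ (∀ d ∈ c', d ∈ c) ∧
      Multiset.card c' + p * t = Multiset.card c ∧ q c' = q c ∧ R c (e.map (p * ·) + c') := by
  induction t generalizing c with
  | zero => exact ⟨0, c, by simp, by simp, by simp, by simp, rfl, by simpa using R.refl c⟩
  | succ t ih =>
    have : ∃ d ∈ c.toFinset, p < c.count d := by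
      by_contra! hcon
      have := Finset.sum_le_card_nsmul _ _ _ hcon
      rw [Multiset.toFinset_sum_count_eq] at this
      simp only [smul_eq_mul] at this
      have e : c.toFinset.card = q c := rfl
      rw [e] at this
      nlinarith
    obtain ⟨d, hd, hcount⟩ := this
    have hle : Multiset.replicate p d ≤ c := Multiset.le_count_iff_replicate_le.1 (by omega)
    have hsub : c - Multiset.replicate p d ≤ c := Multiset.sub_le_self _ _
    have hqe : q (c - Multiset.replicate p d) = q c := by
      unfold q
      congr 1
      ext x
      simp only [Multiset.mem_toFinset]
      constructor
      · exact fun hx => Multiset.mem_of_le hsub hx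
      · intro hx
        rw [← Multiset.count_pos, Multiset.count_sub, Multiset.count_replicate]
        have := Multiset.count_pos.2 hx
        split_ifs with hxd
        · subst hxd; omega
        · omega
    have hcard := Multiset.card_sub hle
    have hcl := Multiset.card_le_card hle
    rw [Multiset.card_replicate] at hcard hcl
    have e1 : p * (t + 1) = p * t + p := by ring
    obtain ⟨e, c', he, hec, hcc, h1, h2, hr⟩ := ih (c - Multiset.replicate p d) (by
      rw [hcard, hqe]
      omega)
    refine ⟨e + {d}, c', by simp [he], ?_, fun x hx => Multiset.mem_of_le hsub (hcc x hx),
      by omega, by rw [h2, hqe], ?_⟩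
    · intro x hx
      rcases Multiset.mem_add.1 hx with hx | hx
      · exact Multiset.mem_of_le hsub (hec x hx)
      · rw [Multiset.mem_singleton.1 hx]; simpa using hd
    · have := hr.add (R.move p d hp)
      rw [Multiset.sub_add_cancel hle] at this
      rw [Multiset.map_add, Multiset.map_singleton, add_right_comm]
      exact this

theorem step1 {m p : ℕ} (hm : 0 < m) (hp : 2 ≤ p) (h1 : A1 m) (h2 : A2 m)
    (c1 c2 : Multiset ℕ) (hc1 : ∀ d ∈ c1, d ∣ m) (hc2 : ∀ d ∈ c2, d ∣ m)
    (h : p * m ≤ Multiset.card c1 + Multiset.card c2) :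
    R (c1.map (p * ·) + c2) {p * m} := by
  obtain ⟨r, rfl⟩ := Nat.exists_eq_add_of_le' hp
  by_cases hge : m ≤ Multiset.card c1
  · have := ((h1 c1 hc1 hge).scale (r + 2)).add (R.drop c2)
    simpa using this
  push Not at hge
  obtain ⟨t, ht⟩ := Nat.exists_eq_add_of_lt hge
  by_cases hx : (r + 2) * (t + 1) + (r + 2 - 1) * q c2 < Multiset.card c2 + (r + 2)
  · obtain ⟨e, he, hec, hr⟩ := X1 (by omega) (t + 1) c2 hx
    have := (h1 (c1 + e) (by
      intro d hd
      rcases Multiset.mem_add.1 hd with hd | hd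
      · exact hc1 d hd
      · exact hc2 d (hec d hd)) (by rw [Multiset.card_add]; omega)).scale (r + 2)
    refine ((R.refl _).add hr).trans ?_
    simpa using this
  · have hq : Multiset.card c1 < q c2 := by
      by_contra! hcon
      push Not at hx
      have e : r + 2 - 1 = r + 1 := rfl
      rw [e] at hx
      have := Nat.mul_le_mul_left (r + 1) hcon
      rw [ht] at h
      nlinarith
    have := Ak hm h1 h2 (r + 2) hp c2 hc2 (by omega)
    have := (R.drop (c1.map ((r + 2) * ·))).add
      (R.up (j := 1) (by omega : 0 < r + 2) (by simpa using this))
    simpa using this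

theorem step2 {m p : ℕ} (hm : 0 < m) (hp : 2 ≤ p) (h1 : A1 m) (h2 : A2 m)
    (c1 c2 : Multiset ℕ) (hc1 : ∀ d ∈ c1, d ∣ m) (hc2 : ∀ d ∈ c2, d ∣ m)
    (h : 2 * (p * m) < Multiset.card c1 + q c1 + (Multiset.card c2 + q c2)) :
    R (c1.map (p * ·) + c2) (Multiset.replicate 2 (p * m)) := by
  by_cases ha : 2 * m < Multiset.card c1 + q c1
  · have := ((h2 c1 hc1 ha).scale p).add (R.drop c2)
    simpa using this
  push Not at ha
  have key : ∀ c' : Multiset ℕ, (∀ d ∈ c', d ∣ m) → p * m < Multiset.card c' + q c' →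
      R c' {p * m} := fun c' hc' hlt => by
    have := Ak hm h1 h2 p hp c' hc' hlt
    simpa using R.up (j := 1) (by omega : 0 < p) (by simpa using this)
  by_cases hge : m ≤ Multiset.card c1
  · have := ((h1 c1 hc1 hge).scale p).add (key c2 hc2 (by nlinarith))
    simpa [Multiset.replicate_succ] using this
  push Not at hge
  obtain ⟨t, ht⟩ := Nat.exists_eq_add_of_lt hge
  have hq1 := q_le_card c1
  have hx : p * (t + 1) + p * q c2 < Multiset.card c2 + p := by
    by_contra! hcon
    have hb := q_bound hm hc2
    have e1 : p * m = p * Multiset.card c1 + p * (t + 1) := by rw [ht]; ring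
    have h3 : 2 * Multiset.card c1 ≤ p * Multiset.card c1 := Nat.mul_le_mul_right _ hp
    have h4 : p * m + p < p * q c2 + q c2 := by omega
    have h5 : p * (3 * q c2) ≤ p * (2 * (m + 1)) := Nat.mul_le_mul_left _ hb
    have h6 : 2 * (m + 1) ≤ p * (m + 1) := Nat.mul_le_mul_right _ hp
    nlinarith
  obtain ⟨e, c', he, hec, hcc, hcard, hq, hr⟩ := X2 (by omega) (t + 1) c2 hx
  have r1 := (h1 (c1 + e) (by
      intro d hd
      rcases Multiset.mem_add.1 hd with hd | hd
      · exact hc1 d hd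
      · exact hc2 d (hec d hd)) (by rw [Multiset.card_add]; omega)).scale p
  have r2 := key c' (fun d hd => hc2 d (hcc d hd)) (by
    have e1 : p * m = p * Multiset.card c1 + p * (t + 1) := by rw [ht]; ring
    have h3 : 2 * Multiset.card c1 ≤ p * Multiset.card c1 := Nat.mul_le_mul_right _ hp
    omega)
  refine ((R.refl _).add hr).trans ?_
  have := r1.add r2
  rw [← add_assoc]
  simpa [Multiset.replicate_succ] using this

theorem split {m p : ℕ} (hp : p.Prime) (c : Multiset ℕ) (hc : ∀ d ∈ c, d ∣ p * m) :
    ∃ c1 c2 : Multiset ℕ, (∀ d ∈ c1, d ∣ m) ∧ (∀ d ∈ c2, d ∣ m) ∧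
      c = c1.map (p * ·) + c2 ∧ q c ≤ q c1 + q c2 := by
  have hpd : ∀ d, d ∣ p * m → ¬ d ∣ m → p * (d / p) = d := by
    intro d hd hn
    apply Nat.mul_div_cancel'
    by_contra hpd
    exact hn (((Nat.Prime.coprime_iff_not_dvd hp).2 hpd).symm.dvd_of_dvd_mul_left hd)
  have hmap : ((c.filter (fun d => ¬ d ∣ m)).map (· / p)).map (p * ·) =
      c.filter (fun d => ¬ d ∣ m) := by
    rw [Multiset.map_map]
    conv_rhs => rw [← Multiset.map_id (c.filter (fun d => ¬ d ∣ m))]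
    apply Multiset.map_congr rfl
    intro d hd
    rw [Multiset.mem_filter] at hd
    exact hpd d (hc d hd.1) hd.2
  have hsum : c = ((c.filter (fun d => ¬ d ∣ m)).map (· / p)).map (p * ·) +
      c.filter (fun d => d ∣ m) := by
    rw [hmap, add_comm, Multiset.filter_add_not]
  refine ⟨(c.filter (fun d => ¬ d ∣ m)).map (· / p), c.filter (fun d => d ∣ m), ?_, ?_, hsum, ?_⟩
  · intro x hx
    obtain ⟨d, hd, rfl⟩ := Multiset.mem_map.1 hx
    rw [Multiset.mem_filter] at hd
    have h1 := hpd d (hc d hd.1) hd.2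
    have h2 := hc d hd.1
    rw [← h1] at h2
    exact Nat.dvd_of_mul_dvd_mul_left hp.pos h2
  · intro x hx
    exact (Multiset.mem_filter.1 hx).2
  · conv_lhs => rw [hsum]
    unfold q
    rw [Multiset.toFinset_add]
    refine (Finset.card_union_le _ _).trans ?_
    refine Nat.add_le_add_right ?_ _
    generalize (c.filter (fun d => ¬ d ∣ m)).map (· / p) = u
    have : (u.map (p * ·)).toFinset ⊆ u.toFinset.image (p * ·) := by
      intro x hx
      simpa using hx
    exact (Finset.card_le_card this).trans Finset.card_image_le

theorem main (n : ℕ) : 0 < n → A1 n ∧ A2 n := by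
  induction n using induction_on_primes with
  | zero => intro h; omega
  | one =>
    intro _
    have hrep : ∀ c : Multiset ℕ, (∀ d ∈ c, d ∣ 1) → c = Multiset.replicate (Multiset.card c) 1 :=
      fun c hc => Multiset.eq_replicate_card.2 (fun d hd => Nat.dvd_one.1 (hc d hd))
    constructor
    · intro c hc h
      rw [hrep c hc]
      exact R.of_le ((Multiset.replicate_le_replicate (k := 1) 1).2 h)
    · intro c hc h
      have := q_le one_pos hc
      rw [hrep c hc]
      exact R.of_le ((Multiset.replicate_le_replicate 1).2 (by omega))
  | prime_mul p m hp ih =>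
    intro hpos
    have hm : 0 < m := Nat.pos_of_mul_pos_left hpos
    obtain ⟨h1, h2⟩ := ih hm
    constructor
    · intro c hc h
      obtain ⟨c1, c2, hc1, hc2, rfl, -⟩ := split hp c hc
      exact step1 hm hp.two_le h1 h2 c1 c2 hc1 hc2 (by simpa using h)
    · intro c hc h
      obtain ⟨c1, c2, hc1, hc2, rfl, hq⟩ := split hp c hc
      refine step2 hm hp.two_le h1 h2 c1 c2 hc1 hc2 ?_
      rw [Multiset.card_add, Multiset.card_map] at h
      omega

theorem zero_sum {ι : Type*} (f : ι → ℤ) (M : Multiset ι) (hM : 0 < Multiset.card M) :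
    ∃ M0 ≤ M, M0 ≠ 0 ∧ ((Multiset.card M : ℕ) : ℤ) ∣ (M0.map f).sum := by
  induction M using Quotient.inductionOn with
  | h l =>
    simp only [Multiset.quot_mk_to_coe, Multiset.coe_card] at hM ⊢
    obtain ⟨i, hi, j, hj, hij, he⟩ := Finset.exists_ne_map_eq_of_card_lt_of_maps_to
      (s := Finset.range (l.length + 1)) (t := Finset.Ico (0 : ℤ) l.length)
      (by simp) (f := fun i => ((l.take i).map f).sum % (l.length : ℤ)) (by
        intro i _
        simp only [Finset.coe_Ico, Set.mem_Ico]
        exact ⟨Int.emod_nonneg _ (by omega), Int.emod_lt_of_pos _ (by omega)⟩)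
    wlog hlt : i < j generalizing i j
    · exact this j hj i hi hij.symm he.symm (by omega)
    refine ⟨((l.take j).drop i : List ι), ?_, ?_, ?_⟩
    · exact Multiset.coe_le.2 ((List.drop_sublist _ _).trans (List.take_sublist _ _)).subperm
    · intro h0
      have := congrArg Multiset.card h0
      simp at this hj
      omega
    · have h1 : ((l.take j).map f).sum =
          ((l.take i).map f).sum + (((l.take j).drop i).map f).sum := by
        conv_lhs => rw [← List.take_append_drop i (l.take j)]
        rw [List.map_append, List.sum_append, List.take_take, min_eq_left hlt.le]
      have h2 := Int.emod_emod_of_dvd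
      have h3 : (l.length : ℤ) ∣ ((l.take j).map f).sum - ((l.take i).map f).sum :=
        Int.ModEq.dvd he
      rw [h1, add_sub_cancel_left] at h3
      simpa using h3

/-- a block `b` realizes a pebble at `d` -/
def P {ι : Type*} (a : ι → ℤ) (g : ι → ℕ) (b : Multiset ι) (d : ℕ) : Prop :=
  b ≠ 0 ∧ (d : ℤ) ∣ (b.map a).sum ∧ (b.map g).sum ≤ d

theorem join_dvd {ι : Type*} (a : ι → ℤ) (d : ℕ) (M : Multiset (Multiset ι)) :
    (M.join.map a).sum = (M.map fun b => (b.map a).sum).sum := by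
  induction M using Multiset.induction_on with
  | empty => simp
  | cons b M ih => simp [ih]

theorem join_g {ι : Type*} (g : ι → ℕ) (M : Multiset (Multiset ι)) :
    (M.join.map g).sum = (M.map fun b => (b.map g).sum).sum := by
  induction M using Multiset.induction_on with
  | empty => simp
  | cons b M ih => simp [ih]

theorem join_mono {ι : Type*} {M N : Multiset (Multiset ι)} (h : M ≤ N) : M.join ≤ N.join := by
  obtain ⟨c, rfl⟩ := Multiset.le_iff_exists_add.1 h
  rw [Multiset.join_add]
  exact Multiset.le_add_right _ _

theorem sound {ι : Type*} (a : ι → ℤ) (g : ι → ℕ) {s s' : Multiset ℕ} (h : R s s') :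
    ∀ M, Multiset.Rel (P a g) M s → ∃ M', M'.join ≤ M.join ∧ Multiset.Rel (P a g) M' s' := by
  induction h with
  | refl s => exact fun M h => ⟨M, le_rfl, h⟩
  | trans _ _ h1 h2 =>
    intro M hM
    obtain ⟨M1, hl1, hM1⟩ := h1 M hM
    obtain ⟨M2, hl2, hM2⟩ := h2 M1 hM1
    exact ⟨M2, hl2.trans hl1, hM2⟩
  | addr c _ h =>
    intro M hM
    obtain ⟨M1, M2, hM1, hM2, rfl⟩ := Multiset.rel_add_right.1 hM
    obtain ⟨M', hl, hM'⟩ := h M1 hM1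
    refine ⟨M' + M2, ?_, hM'.add hM2⟩
    rw [Multiset.join_add, Multiset.join_add]
    gcongr
  | drop s => exact fun M _ => ⟨0, by simp, by simp⟩
  | move p d hp =>
    intro M hM
    have hcard : Multiset.card M = p := by simpa using Multiset.card_eq_card_of_rel hM
    have hall : ∀ b ∈ M, P a g b d := by
      intro b hb
      obtain ⟨e, he, hbe⟩ := Multiset.exists_mem_of_rel_of_mem hM hb
      rwa [Multiset.eq_of_mem_replicate he] at hbe
    obtain ⟨M0, hle, hne, hdvd⟩ := zero_sum (fun b : Multiset ι => (b.map a).sum / (d : ℤ)) M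
      (by omega)
    refine ⟨{M0.join}, by simpa using join_mono hle, ?_⟩
    have hall0 : ∀ b ∈ M0, P a g b d := fun b hb => hall b (Multiset.mem_of_le hle hb)
    refine Multiset.Rel.cons ⟨?_, ?_, ?_⟩ Multiset.Rel.zero
    · intro h0
      obtain ⟨b, hb⟩ := Multiset.exists_mem_of_ne_zero hne
      obtain ⟨x, hx⟩ := Multiset.exists_mem_of_ne_zero (hall0 b hb).1
      have : x ∈ M0.join := Multiset.mem_join.2 ⟨b, hb, hx⟩
      rw [h0] at this
      simp at this
    · rw [join_dvd a d]
      have : (M0.map fun b => (b.map a).sum) =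
          M0.map fun b => (b.map a).sum / (d : ℤ) * (d : ℤ) :=
        Multiset.map_congr rfl fun b hb => (Int.ediv_mul_cancel (hall0 b hb).2.1).symm
      rw [this, Multiset.sum_map_mul_right]
      push_cast
      rw [hcard] at hdvd
      exact mul_dvd_mul_right hdvd _
    · rw [join_g]
      have h1 := Multiset.sum_le_card_nsmul (M0.map fun b => (b.map g).sum) d (by
        intro x hx
        obtain ⟨b, hb, rfl⟩ := Multiset.mem_map.1 hx
        exact (hall0 b hb).2.2)
      rw [Multiset.card_map, smul_eq_mul] at h1
      have h2 := Multiset.card_le_card hle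
      rw [hcard] at h2
      exact h1.trans (Nat.mul_le_mul_right _ h2)

end KL


/-- Kleitman–Lemke / Chung theorem: every sequence of n integers has a nonempty
subsequence summing to 0 mod n with the sum of the gcd's with n at most n. -/
theorem zero_sum_gcd_bound (n : ℕ) (hn : 0 < n) (a : Fin n → ℤ) :
    ∃ K : Finset (Fin n), K.Nonempty ∧
      ((n : ℤ) ∣ ∑ k ∈ K, a k) ∧ (∑ k ∈ K, Int.gcd (a k) (n : ℤ) ≤ n) := by
  classical
  have hr := (KL.main n hn).1
    ((Finset.univ : Finset (Fin n)).val.map fun k => Int.gcd (a k) (n : ℤ)) (by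
      intro d hd
      obtain ⟨k, -, rfl⟩ := Multiset.mem_map.1 hd
      have := Int.gcd_dvd_right (a k) (n : ℤ)
      exact_mod_cast this) (by simp)
  obtain ⟨M, hle, hM⟩ := KL.sound a (fun k => Int.gcd (a k) (n : ℤ)) hr
    ((Finset.univ : Finset (Fin n)).val.map fun k => {k}) (by
      rw [Multiset.rel_map]
      apply Multiset.rel_refl_of_refl_on
      intro k _
      refine ⟨by simp, ?_, by simp⟩
      simpa using Int.gcd_dvd_left (a k) (n : ℤ))
  obtain ⟨b, M', hb, hM', rfl⟩ := Multiset.rel_cons_right.1 hM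
  rw [Multiset.rel_zero_right] at hM'
  subst hM'
  have hj : (((Finset.univ : Finset (Fin n)).val.map fun k => ({k} : Multiset (Fin n)))).join =
      (Finset.univ : Finset (Fin n)).val := by
    change Multiset.bind _ _ = _
    rw [Multiset.bind_singleton, Multiset.map_id']
  rw [hj] at hle
  have hb' : b ≤ (Finset.univ : Finset (Fin n)).val := by simpa using hle
  refine ⟨⟨b, Multiset.nodup_of_le hb' Finset.univ.nodup⟩, ?_, hb.2.1, hb.2.2⟩
  obtain ⟨x, hx⟩ := Multiset.exists_mem_of_ne_zero hb.1
  exact ⟨x, hx⟩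
end

section
/- Let p be a prime, m a positive integer, and e_1 ≥ e_2 ≥ ... ≥ e_m ≥ 1 integers, and let G = ⊕_{j=1}^m ℤ/p^{e_j}ℤ, so that |G| = p^{e_1 + ... + e_m}. For every sequence (g_k), k = 1, ..., |G|, of |G| elements of G there is a nonempty subset K of {1, ..., |G|} such that ∑_{k ∈ K} g_k = 0_G and ∑_{k ∈ K} 1/|g_k| ≤ 1 (the latter sum taken in the rationals). -/
open Finset in
theorem kl_prefix {G ι : Type*} [AddCommGroup G] [DecidableEq ι] (H : AddSubgroup G) [Finite H]
    (S : Finset ι) (u : ι → G) (hu : ∀ i ∈ S, u i ∈ H) (hS : Nat.card H ≤ S.card) :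
    ∃ B ⊆ S, B.Nonempty ∧ ∑ i ∈ B, u i = 0 := by
  classical
  have : Fintype H := Fintype.ofFinite H
  rw [Nat.card_eq_fintype_card] at hS
  let φ := S.equivFin.symm
  let s : ℕ → H := fun k => ∑ i ∈ (univ : Finset S).filter (fun i => (S.equivFin i : ℕ) < k),
    (⟨u i, hu i i.2⟩ : H)
  obtain ⟨a, ha, b, hb, hab, he⟩ := Finset.exists_ne_map_eq_of_card_lt_of_maps_to
    (s := Finset.range (S.card + 1)) (t := (univ : Finset H)) (f := s)
    (by simp; omega) (by intro x _; simp)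
  wlog hlt : a < b generalizing a b
  · exact this b hb a ha hab.symm he.symm (by omega)
  simp only [Finset.mem_range] at ha hb
  let C := (univ : Finset S).filter (fun i => a ≤ (S.equivFin i : ℕ) ∧ (S.equivFin i : ℕ) < b)
  have hC : s b = s a + ∑ i ∈ C, (⟨u i, hu i i.2⟩ : H) := by
    simp only [s, C]
    rw [← Finset.sum_union]
    · apply Finset.sum_congr _ (fun _ _ => rfl)
      ext i; simp; omega
    · rw [Finset.disjoint_left]; intro i; simp; omega
  rw [he] at hC
  have h0 : ∑ i ∈ C, (⟨u i, hu i i.2⟩ : H) = 0 := by simpa using hC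
  refine ⟨C.map (Function.Embedding.subtype _), ?_, ?_, ?_⟩
  · intro i hi
    simp only [Finset.mem_map, Function.Embedding.coe_subtype] at hi
    obtain ⟨x, _, rfl⟩ := hi
    exact x.2
  · simp only [Finset.map_nonempty]
    exact ⟨S.equivFin.symm ⟨a, by omega⟩, by simp [C, hlt]⟩
  · rw [Finset.sum_map]
    have := congrArg (fun x : H => (x : G)) h0
    simpa using this

open Finset in
theorem kl_elem {G ι : Type*} [AddCommGroup G] [DecidableEq ι] (p : ℕ) (hp : p.Prime)
    (V : AddSubgroup G) [Finite V] (hV : ∀ x ∈ V, p • x = 0)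
    (S : Finset ι) (u : ι → G) (hu : ∀ i ∈ S, u i ∈ V) (hS : Nat.card V ≤ S.card) :
    ∃ B ⊆ S, B.Nonempty ∧ B.card ≤ p ∧ ∑ i ∈ B, u i = 0 := by
  classical
  have : Fintype V := Fintype.ofFinite V
  rw [Nat.card_eq_fintype_card] at hS
  by_cases hz : ∃ i ∈ S, u i = 0
  · obtain ⟨i, hi, h0⟩ := hz
    exact ⟨{i}, by simpa using hi, by simp, by simpa using hp.one_le, by simpa using h0⟩
  push Not at hz
  have hord : ∀ x ∈ V, x ≠ 0 → addOrderOf x = p := fun x hx h0 =>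
    haveI := Fact.mk hp
    addOrderOf_eq_prime (hV x hx) h0
  let T : Finset G := (Set.toFinset (V : Set G)).erase 0
  have hT : T.card + 1 = Fintype.card V := by
    rw [Finset.card_erase_add_one (by simp [V.zero_mem])]
    simp
  obtain ⟨w, hw, hcard⟩ := Finset.exists_lt_card_fiber_of_mul_lt_card_of_maps_to
    (s := S ×ˢ Finset.Ico 1 p) (t := T) (f := fun x => x.2 • u x.1) (n := p - 1)
    (by
      rintro ⟨i, c⟩ hx
      simp only [Finset.mem_product, Finset.mem_Ico] at hx
      simp only [T, Finset.mem_erase, Set.mem_toFinset, SetLike.mem_coe]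
      refine ⟨?_, V.nsmul_mem (hu i hx.1) c⟩
      intro h0
      have := addOrderOf_dvd_of_nsmul_eq_zero h0
      rw [hord _ (hu i hx.1) (hz i hx.1)] at this
      have := Nat.le_of_dvd (by omega) this
      omega)
    (by
      rw [Finset.card_product, Nat.card_Ico]
      have := hp.two_le
      exact Nat.mul_lt_mul_of_pos_right (by omega) (by omega))
  simp only [T, Finset.mem_erase, Set.mem_toFinset, SetLike.mem_coe] at hw
  set F := (S ×ˢ Finset.Ico 1 p).filter (fun x => x.2 • u x.1 = w) with hF
  have hinj : Set.InjOn Prod.fst (F : Set (ι × ℕ)) := by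
    rintro ⟨i, c⟩ h1 ⟨j, d⟩ h2 hij
    simp only at hij
    subst hij
    simp only [hF, Finset.coe_filter, Finset.mem_product, Finset.mem_Ico, Set.mem_ofPred_eq] at h1 h2
    have h3 : c • u i = d • u i := h1.2.trans h2.2.symm
    rw [nsmul_eq_nsmul_iff_modEq, hord _ (hu i h1.1.1) (hz i h1.1.1)] at h3
    have := Nat.ModEq.eq_of_lt_of_lt h3 h1.1.2.2 h2.1.2.2
    simp [this]
  have hc : p ≤ (F.image Prod.fst).card := by
    rw [Finset.card_image_of_injOn hinj]; omega
  obtain ⟨D, hD, hDc⟩ := Finset.exists_subset_card_eq hc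
  have hDS : ∀ i ∈ D, i ∈ S ∧ u i ∈ AddSubgroup.zmultiples w := by
    intro i hi
    have := hD hi
    simp only [hF, Finset.mem_image, Finset.mem_filter, Finset.mem_product, Finset.mem_Ico] at this
    obtain ⟨⟨j, c⟩, ⟨⟨h1, h2⟩, h3⟩, h4⟩ := this
    simp only at h1 h2 h3 h4
    subst h4
    refine ⟨h1, ?_⟩
    have ho := hord _ (hu j h1) (hz j h1)
    have hle : AddSubgroup.zmultiples w ≤ AddSubgroup.zmultiples (u j) := by
      rw [AddSubgroup.zmultiples_le, ← h3]
      exact AddSubgroup.nsmul_mem_zmultiples _ _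
    have hfin : Finite (AddSubgroup.zmultiples (u j)) := by
      apply Nat.finite_of_card_ne_zero
      rw [Nat.card_zmultiples, ho]; exact hp.ne_zero
    have : AddSubgroup.zmultiples w = AddSubgroup.zmultiples (u j) := by
      apply AddSubgroup.eq_of_le_of_card_ge hle
      rw [Nat.card_zmultiples, Nat.card_zmultiples, ho, hord w hw.2 hw.1]
    rw [this]; exact AddSubgroup.mem_zmultiples _
  have hfin : Finite (AddSubgroup.zmultiples w) := by
    apply Nat.finite_of_card_ne_zero
    rw [Nat.card_zmultiples, hord w hw.2 hw.1]; exact hp.ne_zero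
  obtain ⟨B, hB, hBn, hB0⟩ := kl_prefix (AddSubgroup.zmultiples w) D u (fun i hi => (hDS i hi).2)
    (by rw [Nat.card_zmultiples, hord w hw.2 hw.1, hDc])
  exact ⟨B, fun i hi => (hDS i (hB hi)).1, hBn, hDc ▸ Finset.card_le_card hB, hB0⟩

open Finset in
theorem kl_extract {G ι : Type*} [AddCommGroup G] [DecidableEq ι] (p : ℕ) (hp : p.Prime)
    (V : AddSubgroup G) [Finite V] (hV : ∀ x ∈ V, p • x = 0)
    (S : Finset ι) (u : ι → G) (hu : ∀ i ∈ S, u i ∈ V) (t : ℕ)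
    (hS : ∀ s < t, p * s + Nat.card V ≤ S.card) :
    ∃ P : Finset (Finset ι), P.card = t ∧ (P : Set (Finset ι)).PairwiseDisjoint id ∧
      ∀ B ∈ P, B ⊆ S ∧ B.Nonempty ∧ B.card ≤ p ∧ ∑ i ∈ B, u i = 0 := by
  induction t with
  | zero => exact ⟨∅, by simp⟩
  | succ t ih =>
    obtain ⟨P, hPc, hPd, hP⟩ := ih (fun s hs => hS s (by omega))
    have h1 : (P.biUnion id).card ≤ P.card * p :=
      Finset.card_biUnion_le_card_mul _ _ _ (fun B hB => (hP B hB).2.2.1)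
    have h2 := Finset.le_card_sdiff (P.biUnion id) S
    have h3 := hS t (by omega)
    rw [hPc, mul_comm] at h1
    obtain ⟨B, hB, hBn, hBc, hB0⟩ := kl_elem p hp V hV (S \ P.biUnion id) u
      (fun i hi => hu i (Finset.mem_sdiff.1 hi).1) (by omega)
    have hdis : ∀ C ∈ P, Disjoint B C := by
      intro C hC
      rw [Finset.disjoint_left]
      intro i hi hiC
      exact (Finset.mem_sdiff.1 (hB hi)).2 (Finset.mem_biUnion.2 ⟨C, hC, hiC⟩)
    have hBP : B ∉ P := fun h => hBn.ne_empty (by simpa using hdis B h)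
    refine ⟨insert B P, by rw [Finset.card_insert_of_notMem hBP, hPc], ?_, ?_⟩
    · rw [Finset.coe_insert]
      exact hPd.insert (fun C hC _ => hdis C hC)
    · intro C hC
      rcases Finset.mem_insert.1 hC with rfl | hC
      · exact ⟨hB.trans Finset.sdiff_subset, hBn, hBc, hB0⟩
      · exact hP C hC

theorem kl_arith (p v h r n : ℕ) (hp : 2 ≤ p) (hv : p ≤ v) (hn : v * h ≤ n + r) (s : ℕ)
    (hs : s < h - r) : p * s + v ≤ n := by
  obtain ⟨d, rfl⟩ : ∃ d, h = s + r + 1 + d := ⟨h - (s + r + 1), by omega⟩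
  obtain ⟨c, rfl⟩ : ∃ c, v = p + c := ⟨v - p, by omega⟩
  have : (p + c) * (s + r + 1 + d) = p * s + c * s + (p + c) * r + (p + c) + (p+c) * d := by ring
  have : r ≤ (p + c) * r := Nat.le_mul_of_pos_left _ (by omega)
  have := Nat.zero_le (c * s)
  have := Nat.zero_le ((p + c) * d)
  omega

open Finset in
theorem kl_main {G : Type*} [AddCommGroup G] [Finite G] (p : ℕ) (hp : p.Prime) (a : ℕ) :
    ∀ (ι : Type) (I : Finset ι) (f : ι → G), (∀ i ∈ I, p ^ a • f i = 0) →
      Nat.card (nsmulAddMonoidHom (α := G) (p ^ a)).ker ≤ I.card →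
      ∃ K ⊆ I, K.Nonempty ∧ ∑ k ∈ K, f k = 0 ∧
        ∑ k ∈ K, (1 : ℚ) / (addOrderOf (f k) : ℚ) ≤ 1 := by
  classical
  induction a with
  | zero =>
    intro ι I f hf hI
    have : 0 < Nat.card (nsmulAddMonoidHom (α := G) (p ^ 0)).ker := Nat.card_pos
    obtain ⟨i, hi⟩ := Finset.card_pos.1 (this.trans_le hI)
    have h0 : f i = 0 := by simpa using hf i hi
    exact ⟨{i}, by simpa using hi, by simp, by simp [h0], by simp [h0]⟩
  | succ a ih =>
    intro ι I f hf hI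
    set H := (nsmulAddMonoidHom (α := G) (p ^ a)).ker with hH
    set H' := (nsmulAddMonoidHom (α := G) (p ^ (a + 1))).ker with hH'
    set V := H'.map (nsmulAddMonoidHom (α := G) (p ^ a)) with hVdef
    have hle : H ≤ H' := by
      intro x hx
      simp only [hH, hH', AddMonoidHom.mem_ker, nsmulAddMonoidHom_apply] at hx ⊢
      rw [pow_succ, mul_comm, mul_nsmul', hx, nsmul_zero]
    have hcard : Nat.card V * Nat.card H = Nat.card H' := by
      rw [hVdef, ← AddSubgroup.relIndex_ker, mul_comm]
      rw [← AddSubgroup.relIndex_bot_left, ← AddSubgroup.relIndex_bot_left]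
      exact AddSubgroup.relIndex_mul_relIndex _ _ _ bot_le hle
    have hV : ∀ x ∈ V, p • x = 0 := by
      rintro x ⟨y, hy, rfl⟩
      simp only [hH', SetLike.mem_coe, AddMonoidHom.mem_ker, nsmulAddMonoidHom_apply] at hy ⊢
      rw [← mul_nsmul', ← pow_succ', hy]
    set top := I.filter (fun i => p ^ a • f i ≠ 0) with htop
    set rest := I.filter (fun i => p ^ a • f i = 0) with hrest
    have hsum : rest.card + top.card = I.card := Finset.card_filter_add_card_filter_not _
    have hu : ∀ i ∈ top, p ^ a • f i ∈ V := by
      intro i hi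
      refine ⟨f i, ?_, rfl⟩
      simpa [hH'] using hf i (Finset.mem_filter.1 hi).1
    have hvp : top.Nonempty → p ≤ Nat.card V := by
      rintro ⟨i, hi⟩
      have := Fact.mk hp
      have ho := addOrderOf_eq_prime (hV _ (hu i hi)) (Finset.mem_filter.1 hi).2
      have hd : addOrderOf (⟨_, hu i hi⟩ : V) ∣ Nat.card V := addOrderOf_dvd_natCard _
      rw [← AddSubgroup.addOrderOf_coe, ho] at hd
      exact Nat.le_of_dvd Nat.card_pos hd
    have hS : ∀ s < Nat.card H - rest.card, p * s + Nat.card V ≤ top.card := by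
      intro s hs
      rcases Finset.eq_empty_or_nonempty top with h0 | h0
      · have : Nat.card H ≤ Nat.card H' :=
          hcard ▸ Nat.le_mul_of_pos_left _ Nat.card_pos
        rw [h0, Finset.card_empty] at hsum
        omega
      · exact kl_arith p _ _ rest.card _ hp.two_le (hvp h0) (by omega) s hs
    obtain ⟨P, hPc, hPd, hP⟩ := kl_extract p hp V hV top (fun i => p ^ a • f i) hu _ hS
    set R := rest.image (fun i => ({i} : Finset ι)) with hR
    have hRc : R.card = rest.card :=
      Finset.card_image_of_injective _ Finset.singleton_injective
    have htr : Disjoint top rest := (Finset.disjoint_filter_filter_not _ _ _).symm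
    have hRs : ∀ C ∈ R, C ⊆ rest := by
      intro C hC
      obtain ⟨i, hi, rfl⟩ := Finset.mem_image.1 hC
      simpa using hi
    have hRP : ∀ B ∈ P, ∀ C ∈ R, Disjoint B C := fun B hB C hC =>
      Finset.disjoint_of_subset_left (hP B hB).1 (Finset.disjoint_of_subset_right (hRs C hC) htr)
    have hPR : Disjoint P R := by
      rw [Finset.disjoint_left]
      intro B hB hB'
      exact (hP B hB).2.1.ne_empty (by simpa using hRP B hB B hB')
    have hdis : ((P ∪ R : Finset (Finset ι)) : Set (Finset ι)).PairwiseDisjoint id := by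
      rw [Finset.coe_union, Set.pairwiseDisjoint_union]
      refine ⟨hPd, ?_, fun B hB C hC _ => hRP B hB C hC⟩
      intro B hB C hC hne
      obtain ⟨i, hi, rfl⟩ := Finset.mem_image.1 hB
      obtain ⟨j, hj, rfl⟩ := Finset.mem_image.1 hC
      change Disjoint ({i} : Finset ι) {j}
      rw [Finset.disjoint_singleton]
      exact fun h : i = j => hne (by rw [h])
    have hzero : ∀ B ∈ P ∪ R, p ^ a • ∑ i ∈ B, f i = 0 := by
      intro B hB
      rcases Finset.mem_union.1 hB with hB | hB
      · rw [Finset.smul_sum]; exact (hP B hB).2.2.2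
      · obtain ⟨i, hi, rfl⟩ := Finset.mem_image.1 hB
        simpa using (Finset.mem_filter.1 hi).2
    obtain ⟨K, hK, hKn, hK0, hK1⟩ := ih (Finset ι) (P ∪ R) (fun B => ∑ i ∈ B, f i) hzero
      (by rw [Finset.card_union_of_disjoint hPR, hPc, hRc]; omega)
    have hKd : (K : Set (Finset ι)).PairwiseDisjoint id := hdis.subset (by exact_mod_cast hK)
    refine ⟨K.biUnion id, ?_, ?_, ?_, ?_⟩
    · rw [Finset.biUnion_subset]
      intro B hB
      rcases Finset.mem_union.1 (hK hB) with hB | hB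
      · exact (hP B hB).1.trans (Finset.filter_subset _ _)
      · exact (hRs B hB).trans (Finset.filter_subset _ _)
    · obtain ⟨B, hB⟩ := hKn
      have : B.Nonempty := by
        rcases Finset.mem_union.1 (hK hB) with hB | hB
        · exact (hP B hB).2.1
        · obtain ⟨i, hi, rfl⟩ := Finset.mem_image.1 hB
          simp
      obtain ⟨i, hi⟩ := this
      exact ⟨i, Finset.mem_biUnion.2 ⟨B, hB, hi⟩⟩
    · rw [Finset.sum_biUnion hKd]; exact hK0
    · rw [Finset.sum_biUnion hKd]
      refine le_trans (Finset.sum_le_sum fun B hB => ?_) hK1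
      rcases Finset.mem_union.1 (hK hB) with hB | hB
      · have hpa : (0 : ℚ) < (p : ℚ) ^ a := by have := hp.pos; positivity
        have hp0 : (0 : ℚ) < p := by exact_mod_cast hp.pos
        have h1 : ∀ i ∈ B, (1 : ℚ) / (addOrderOf (f i) : ℚ) = 1 / (p : ℚ) ^ (a + 1) := by
          intro i hi
          have hit := Finset.mem_filter.1 ((hP B hB).1 hi)
          have := Fact.mk hp
          rw [addOrderOf_eq_prime_pow hit.2 (hf i hit.1)]
          push_cast; rfl
        simp only [id]
        rw [Finset.sum_congr rfl h1, Finset.sum_const, nsmul_eq_mul]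
        have hd : addOrderOf (∑ i ∈ B, f i) ≤ p ^ a :=
          Nat.le_of_dvd (pow_pos hp.pos _)
            (addOrderOf_dvd_of_nsmul_eq_zero (hzero B (Finset.mem_union_left _ hB)))
        have hd' : (addOrderOf (∑ i ∈ B, f i) : ℚ) ≤ (p : ℚ) ^ a := by exact_mod_cast hd
        have hpos : (0 : ℚ) < addOrderOf (∑ i ∈ B, f i) := by
          exact_mod_cast addOrderOf_pos _
        have hBc : (B.card : ℚ) ≤ p := by exact_mod_cast (hP B hB).2.2.1
        calc (B.card : ℚ) * (1 / (p : ℚ) ^ (a + 1)) ≤ p * (1 / (p : ℚ) ^ (a + 1)) := by gcongr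
          _ = 1 / (p : ℚ) ^ a := by field_simp; ring
          _ ≤ _ := one_div_le_one_div_of_le hpos hd'
      · obtain ⟨i, hi, rfl⟩ := Finset.mem_image.1 hB
        simp

/-- The Kleitman–Lemke statement for abelian p-groups
G = ⊕_{j=1}^m ℤ/p^{e_j}ℤ with e_1 ≥ e_2 ≥ ⋯ ≥ e_m ≥ 1. -/
theorem zero_sum_reciprocal_orders_p_group (p : ℕ) (hp : p.Prime)
    (m : ℕ) (hm : 0 < m) (e : Fin m → ℕ)
    (he1 : ∀ j, 1 ≤ e j) (hmono : ∀ i j : Fin m, i ≤ j → e j ≤ e i)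
    (g : Fin (p ^ (∑ j, e j)) → (∀ j : Fin m, ZMod (p ^ e j))) :
    ∃ K : Finset (Fin (p ^ (∑ j, e j))), K.Nonempty ∧
      (∑ k ∈ K, g k = 0) ∧ (∑ k ∈ K, (1 : ℚ) / (addOrderOf (g k) : ℚ) ≤ 1) := by
  have hne : ∀ j, NeZero (p ^ e j) := fun j => ⟨pow_ne_zero _ hp.ne_zero⟩
  have hc : Nat.card (∀ j : Fin m, ZMod (p ^ e j)) = p ^ (∑ j, e j) := by
    rw [Nat.card_pi, ← Finset.prod_pow_eq_pow_sum]
    simp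
  obtain ⟨K, _, h⟩ := kl_main (G := ∀ j : Fin m, ZMod (p ^ e j)) p hp (∑ j, e j) _
    Finset.univ g (fun i _ => by rw [← hc]; exact card_nsmul_eq_zero')
    (by
      rw [Finset.card_univ, Fintype.card_fin]
      refine le_trans ?_ hc.le
      exact Nat.card_le_card_of_injective _ Subtype.val_injective)
  exact ⟨K, h⟩
end
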